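/- arXiv:1402.1155 — 2 statements merged into one kernel-verified Lean document; each statement's English description precedes it below -/
import Mathlib

section
/- Let (Ω, F, (F_t)_{t≥0}, P) be a filtered probability space satisfying the usual conditions, and let X be a measurable process such that the random variable X_T·1_{[T<∞]} is σ-integrable with respect to F_T for every stopping time T. Then there exists a unique (up to indistinguishability) optional process ^oX such that for every stopping time T, E[X_T·1_{[T<∞]} | F_T] = (^oX)_T·1_{[T<∞]} a.s., where E[·|F_T] denotes the generalized conditional expectation. -/
open MeasureTheory Filter
open scoped ENNReal NNReal

/-- A random variable `ξ` is σ-integrable with respect to the sub-σ-field `G` if there is a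
sequence of sets `s n ∈ G` increasing to `Ω` such that `ξ · 1_{s n}` is integrable for each `n`. -/
def SigmaIntegrable {Ω : Type*} {mΩ : MeasurableSpace Ω} (μ : Measure Ω)
    (G : MeasurableSpace Ω) (ξ : Ω → ℝ) : Prop :=
  ∃ s : ℕ → Set Ω, (∀ n, MeasurableSet[G] (s n)) ∧ Monotone s ∧
    (⋃ n, s n) = Set.univ ∧ ∀ n, Integrable ((s n).indicator ξ) μ

/-- `η` is (a version of) the generalized conditional expectation `E[ξ ∣ G]`:  `η` is
`G`-measurable and `E[ξ · 1_A] = E[η · 1_A]` for every `A ∈ G` such that `ξ · 1_A` is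
integrable. -/
def IsGCE {Ω : Type*} {mΩ : MeasurableSpace Ω} (μ : Measure Ω)
    (G : MeasurableSpace Ω) (ξ η : Ω → ℝ) : Prop :=
  Measurable[G] η ∧ ∀ A : Set Ω, MeasurableSet[G] A → Integrable (A.indicator ξ) μ →
    ∫ ω, A.indicator ξ ω ∂μ = ∫ ω, A.indicator η ω ∂μ

noncomputable section

/-- The stopped value `X_T · 1_{[T<∞]}` of a process `X` at the `[0,∞]`-valued random time `T`. -/
def stoppedVal {Ω : Type*} (X : ℝ≥0 → Ω → ℝ) (T : Ω → ℝ≥0∞) : Ω → ℝ :=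
  {ω | T ω < ∞}.indicator fun ω => X (T ω).toNNReal ω

/-- `T` is a stopping time of the filtration `ℱ`: `[T ≤ t] ∈ ℱ t` for all `t ≥ 0`. -/
def IsStopTime {Ω : Type*} [mΩ : MeasurableSpace Ω] (ℱ : Filtration ℝ≥0 mΩ)
    (T : Ω → ℝ≥0∞) : Prop :=
  ∀ t : ℝ≥0, MeasurableSet[ℱ t] {ω | T ω ≤ (t : ℝ≥0∞)}

/-- The σ-field `F_T` of events prior to the stopping time `T`:
`F_T = {A ∈ F_∞ ∣ A ∩ [T ≤ t] ∈ ℱ t for all t ≥ 0}`. -/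
def sigmaAt {Ω : Type*} [mΩ : MeasurableSpace Ω] (ℱ : Filtration ℝ≥0 mΩ) (T : Ω → ℝ≥0∞)
    (hT : IsStopTime ℱ T) : MeasurableSpace Ω where
  MeasurableSet' A := MeasurableSet[⨆ t : ℝ≥0, (ℱ t : MeasurableSpace Ω)] A ∧
    ∀ t : ℝ≥0, MeasurableSet[ℱ t] (A ∩ {ω | T ω ≤ (t : ℝ≥0∞)})
  measurableSet_empty :=
    ⟨@MeasurableSet.empty Ω (⨆ t : ℝ≥0, (ℱ t : MeasurableSpace Ω)), fun t => by simp⟩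
  measurableSet_compl A hA := ⟨hA.1.compl, fun t => by
    have h : Aᶜ ∩ {ω | T ω ≤ (t : ℝ≥0∞)} =
        {ω | T ω ≤ (t : ℝ≥0∞)} \ (A ∩ {ω | T ω ≤ (t : ℝ≥0∞)}) := by
      ext ω; by_cases hω : T ω ≤ (t : ℝ≥0∞) <;> simp [hω]
    rw [h]
    exact (hT t).diff (hA.2 t)⟩
  measurableSet_iUnion f hf := ⟨MeasurableSet.iUnion fun i => (hf i).1, fun t => by
    rw [Set.iUnion_inter]
    exact MeasurableSet.iUnion fun i => (hf i).2 t⟩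

/-- The usual conditions: the filtration is right-continuous and `ℱ 0` contains all `μ`-null
measurable sets. -/
def UsualConditions {Ω : Type*} [mΩ : MeasurableSpace Ω] (μ : Measure Ω)
    (ℱ : Filtration ℝ≥0 mΩ) : Prop :=
  (∀ t : ℝ≥0, (ℱ t : MeasurableSpace Ω) = ⨅ (s : ℝ≥0) (_ : t < s), (ℱ s : MeasurableSpace Ω)) ∧
  (∀ N : Set Ω, MeasurableSet N → μ N = 0 → MeasurableSet[ℱ 0] N)

/-- The optional σ-field on `ℝ≥0 × Ω`, generated by all càdlàg adapted processes. -/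
def optionalSigma {Ω : Type*} [mΩ : MeasurableSpace Ω] (ℱ : Filtration ℝ≥0 mΩ) :
    MeasurableSpace (ℝ≥0 × Ω) :=
  ⨆ X ∈ {X : ℝ≥0 → Ω → ℝ |
      (∀ ω, ∀ t : ℝ≥0, ContinuousWithinAt (fun s => X s ω) (Set.Ici t) t) ∧
      (∀ ω, ∀ t : ℝ≥0, 0 < t →
        ∃ l : ℝ, Filter.Tendsto (fun s => X s ω) (nhdsWithin t (Set.Iio t)) (nhds l)) ∧
      (∀ t, Measurable[ℱ t] (X t))},
    MeasurableSpace.comap (fun p : ℝ≥0 × Ω => X p.1 p.2) (borel ℝ)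

/-- A process is optional if it is measurable with respect to the optional σ-field. -/
def IsOptional {Ω : Type*} [mΩ : MeasurableSpace Ω] (ℱ : Filtration ℝ≥0 mΩ)
    (Y : ℝ≥0 → Ω → ℝ) : Prop :=
  Measurable[optionalSigma ℱ] fun p : ℝ≥0 × Ω => Y p.1 p.2

/-- A measurable process. -/
def MeasurableProcess {Ω : Type*} [mΩ : MeasurableSpace Ω] (X : ℝ≥0 → Ω → ℝ) : Prop :=
  Measurable fun p : ℝ≥0 × Ω => X p.1 p.2

/-- Membership in `L_op`: `X` is a measurable process such that `X_T · 1_{[T<∞]}` is σ-integrable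
with respect to `F_T` for every stopping time `T`. -/
def MemLop {Ω : Type*} [mΩ : MeasurableSpace Ω] (μ : Measure Ω) (ℱ : Filtration ℝ≥0 mΩ)
    (X : ℝ≥0 → Ω → ℝ) : Prop :=
  MeasurableProcess X ∧
  ∀ (T : Ω → ℝ≥0∞) (hT : IsStopTime ℱ T),
    SigmaIntegrable μ (sigmaAt ℱ T hT) (stoppedVal X T)

/-- Indistinguishability of two processes (equality up to evanescence). -/
def Indist {Ω : Type*} [mΩ : MeasurableSpace Ω] (μ : Measure Ω)
    (X Y : ℝ≥0 → Ω → ℝ) : Prop :=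
  ∀ᵐ ω ∂μ, ∀ t, X t ω = Y t ω

/-- `Y` is an optional projection of `X`: `Y` is optional and, for every stopping time `T`,
`E[X_T · 1_{[T<∞]} ∣ F_T] = Y_T · 1_{[T<∞]}` a.s., with generalized conditional expectations. -/
def IsOptProj {Ω : Type*} [mΩ : MeasurableSpace Ω] (μ : Measure Ω) (ℱ : Filtration ℝ≥0 mΩ)
    (X Y : ℝ≥0 → Ω → ℝ) : Prop :=
  IsOptional ℱ Y ∧
  ∀ (T : Ω → ℝ≥0∞) (hT : IsStopTime ℱ T),
    ∃ η, IsGCE μ (sigmaAt ℱ T hT) (stoppedVal X T) η ∧ η =ᵐ[μ] stoppedVal Y T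

section
lemma op_factor_prod {Ω : Type*} [mΩ : MeasurableSpace Ω] {H : Set (ℝ≥0 × Ω)}
    (hH : MeasurableSet H) :
    ∃ f : Ω → (ℕ → ℝ), Measurable f ∧ ∃ G : Set (ℝ≥0 × (ℕ → ℝ)), MeasurableSet G ∧
      H = {p | (p.1, f p.2) ∈ G} := by
  classical
  rw [← generateFrom_prod] at hH
  induction H, hH using MeasurableSpace.generateFrom_induction with
  | hC H hH _ =>
    obtain ⟨I, hI, A, hA, rfl⟩ := hH
    refine ⟨fun ω _ => A.indicator (fun _ => (1 : ℝ)) ω, ?_, {p | p.1 ∈ I ∧ p.2 0 = 1}, ?_, ?_⟩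
    · refine measurable_pi_lambda _ fun _ => ?_
      exact measurable_const.indicator hA
    · exact (measurable_fst (show MeasurableSet I from hI)).inter
        (measurableSet_eq_fun ((measurable_pi_apply 0).comp measurable_snd) measurable_const)
    · ext p; simp [Set.indicator_apply]
  | empty => exact ⟨fun _ _ => 0, measurable_const, ∅, MeasurableSet.empty, by simp⟩
  | compl H _ ih =>
    obtain ⟨f, hf, G, hG, rfl⟩ := ih
    exact ⟨f, hf, Gᶜ, hG.compl, by ext; simp⟩
  | iUnion H _ ih =>
    choose f hf G hG e using ih
    refine ⟨fun ω k => f k.unpair.1 ω k.unpair.2, ?_,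
      ⋃ n, {p | (p.1, fun j => p.2 (Nat.pair n j)) ∈ G n}, ?_, ?_⟩
    · refine measurable_pi_lambda _ fun k => ?_
      exact (measurable_pi_apply _).comp (hf _)
    · refine MeasurableSet.iUnion fun n => ?_
      refine measurableSet_preimage (f := fun p : ℝ≥0 × (ℕ → ℝ) =>
        (p.1, fun j => p.2 (Nat.pair n j))) ?_ (hG n)
      refine measurable_fst.prodMk (measurable_pi_lambda _ fun j => ?_)
      exact (measurable_pi_apply _).comp measurable_snd
    · ext p
      simp only [Set.mem_iUnion, Set.mem_ofPred_eq, Nat.unpair_pair]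
      refine exists_congr fun n => ?_
      rw [e n]; rfl

lemma op_tube (b : ℕ → ℕ) (O : Set (ℕ → ℕ)) (hO : IsOpen O)
    (hK : {x : ℕ → ℕ | ∀ i, x i ≤ b i} ⊆ O) :
    ∃ k, {x : ℕ → ℕ | ∀ i < k, x i ≤ b i} ⊆ O := by
  by_contra! hcon
  have h2 : ∀ k, ∃ x : ℕ → ℕ, (∀ i < k, x i ≤ b i) ∧ x ∉ O := fun k => by
    obtain ⟨x, hx, hxO⟩ := Set.not_subset.1 (hcon k)
    exact ⟨x, hx, hxO⟩
  choose x hx hxO using h2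
  have hcomp : IsCompact {x : ℕ → ℕ | ∀ i, x i ≤ b i} := by
    have : {x : ℕ → ℕ | ∀ i, x i ≤ b i} = Set.univ.pi fun i => Set.Iic (b i) := by
      ext; simp [Pi.le_def]
    rw [this]
    exact isCompact_univ_pi fun i => (Set.finite_Iic _).isCompact
  obtain ⟨y, hy, φ, hφ, hlim⟩ := hcomp.tendsto_subseq (x := fun k i => min (x k i) (b i))
    (fun k i => min_le_right _ _)
  have hlim' : Tendsto (fun n => x (φ n)) atTop (nhds y) := by
    rw [tendsto_pi_nhds] at hlim ⊢
    intro i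
    refine (hlim i).congr' ?_
    filter_upwards [eventually_gt_atTop i] with n hn
    exact min_eq_left (hx (φ n) i (hn.trans_le (hφ.id_le n)))
  obtain ⟨n, hn⟩ := (hlim'.eventually (hO.mem_nhds (hK hy))).exists
  exact hxO _ hn

/-- Measurable section lemma. -/
lemma op_meas_section {Ω : Type*} [mΩ : MeasurableSpace Ω] (μ : Measure Ω) [IsFiniteMeasure μ]
    {H : Set (ℝ≥0 × Ω)} (hH : MeasurableSet H) (hpos : μ {ω | ∃ t, (t, ω) ∈ H} ≠ 0) :
    ∃ Z : Ω → ℝ≥0, Measurable Z ∧ μ {ω | (Z ω, ω) ∈ H} ≠ 0 := by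
  classical
  obtain ⟨f, hf, G, hG, rfl⟩ := op_factor_prod hH
  have hGa := hG.analyticSet
  rw [AnalyticSet] at hGa
  rcases hGa with rfl | ⟨g, hg, rfl⟩
  · simp at hpos
  set h : (ℕ → ℕ) → (ℕ → ℝ) := fun x => (g x).2 with hh
  have hhc : Continuous h := continuous_snd.comp hg
  obtain ⟨c, hc0, hc⟩ : ∃ c : ℝ≥0∞, 0 < c ∧ c < μ (f ⁻¹' (h '' Set.univ)) := by
    have : μ (f ⁻¹' (h '' Set.univ)) ≠ 0 := by
      convert hpos using 2
      ext ω
      simp only [Set.mem_preimage, Set.mem_image, Set.mem_univ, true_and, Set.mem_ofPred_eq,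
        Set.mem_range, hh]
      constructor
      · rintro ⟨x, hx⟩; exact ⟨(g x).1, x, by rw [← hx]⟩
      · rintro ⟨t, x, hx⟩; exact ⟨x, by rw [hx]⟩
    obtain ⟨c, h1, h2⟩ := exists_between (pos_iff_ne_zero.2 this)
    exact ⟨c, h1, h2⟩
  have step : ∀ (k : ℕ) (D : Set (ℕ → ℕ)), c < μ (f ⁻¹' (h '' D)) →
      ∃ n : ℕ, c < μ (f ⁻¹' (h '' (D ∩ {x | x k ≤ n}))) := by
    intro k D hD
    have e : f ⁻¹' (h '' D) = ⋃ n : ℕ, f ⁻¹' (h '' (D ∩ {x | x k ≤ n})) := by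
      rw [← Set.preimage_iUnion, ← Set.image_iUnion, ← Set.inter_iUnion]
      congr 2
      ext x
      simp only [Set.mem_inter_iff, Set.mem_iUnion, Set.mem_ofPred_eq]
      exact ⟨fun hx => ⟨hx, _, le_rfl⟩, fun hx => hx.1⟩
    have hm : Monotone fun n : ℕ => f ⁻¹' (h '' (D ∩ {x | x k ≤ n})) := by
      intro n m hnm
      refine Set.preimage_mono (Set.image_mono (Set.inter_subset_inter_right _ ?_))
      intro x hx; exact le_trans hx hnm
    rw [e, hm.measure_iUnion] at hD
    exact lt_iSup_iff.1 hD
  let N : ℕ → Set (ℕ → ℕ) → ℕ := fun k D =>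
    if hn : ∃ n : ℕ, c < μ (f ⁻¹' (h '' (D ∩ {x | x k ≤ n}))) then hn.choose else 0
  let D : ℕ → Set (ℕ → ℕ) := fun k => Nat.rec Set.univ (fun k D => D ∩ {x | x k ≤ N k D}) k
  have hD : ∀ k, c < μ (f ⁻¹' (h '' (D k))) := by
    intro k
    induction k with
    | zero => exact hc
    | succ k ih =>
      have hn := step k (D k) ih
      have : N k (D k) = hn.choose := dif_pos hn
      change c < μ (f ⁻¹' (h '' (D k ∩ {x | x k ≤ N k (D k)})))
      rw [this]; exact hn.choose_spec
  set b : ℕ → ℕ := fun k => N k (D k) with hb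
  have hDb : ∀ k, D k = {x | ∀ i < k, x i ≤ b i} := by
    intro k
    induction k with
    | zero => simp [D]
    | succ k ih =>
      change D k ∩ {x | x k ≤ b k} = _
      rw [ih]
      ext x
      simp only [Set.mem_inter_iff, Set.mem_ofPred_eq, Nat.lt_succ_iff_lt_or_eq]
      constructor
      · rintro ⟨h1, h2⟩ i (hi | rfl)
        exacts [h1 i hi, h2]
      · intro h1; exact ⟨fun i hi => h1 i (Or.inl hi), h1 k (Or.inr rfl)⟩
  set K : Set (ℕ → ℕ) := {x | ∀ i, x i ≤ b i} with hKdef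
  have hKc : IsCompact K := by
    have : K = Set.univ.pi fun i => Set.Iic (b i) := by
      ext; simp [hKdef, Pi.le_def]
    rw [this]
    exact isCompact_univ_pi fun i => (Set.finite_Iic _).isCompact
  have hsub : (⋂ k, closure (h '' (D k))) ⊆ h '' K := by
    intro y hy
    by_contra hyK
    have hcl : IsCompact (h '' K) := hKc.image hhc
    obtain ⟨V, W, hV, hW, hKV, hyW, hVW⟩ := hcl.separation_of_notMem hyK
    obtain ⟨k, hk⟩ := op_tube b (h ⁻¹' V) (hV.preimage hhc)
      (fun x hx => hKV ⟨x, hx, rfl⟩)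
    have h1 : y ∈ closure (h '' (D k)) := Set.mem_iInter.1 hy k
    have h2 : h '' (D k) ⊆ V := by
      rw [hDb k]; exact Set.image_subset_iff.2 hk
    obtain ⟨z, hzW, hz⟩ := mem_closure_iff.1 h1 W hW hyW
    exact Set.disjoint_left.1 hVW (h2 hz) hzW
  have hclm : ∀ k, MeasurableSet (f ⁻¹' closure (h '' (D k))) := fun k =>
    hf isClosed_closure.measurableSet
  have hDanti : Antitone D := by
    refine antitone_nat_of_succ_le fun k => ?_
    exact Set.inter_subset_left
  have hcK : c ≤ μ (f ⁻¹' (h '' K)) := by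
    calc c ≤ ⨅ k, μ (f ⁻¹' closure (h '' (D k))) :=
          le_iInf fun k => (hD k).le.trans (measure_mono (Set.preimage_mono subset_closure))
      _ = μ (⋂ k, f ⁻¹' closure (h '' (D k))) := by
          rw [Antitone.measure_iInter]
          · intro i j hij
            exact Set.preimage_mono (closure_mono (Set.image_mono (hDanti hij)))
          · exact fun k => (hclm k).nullMeasurableSet
          · exact ⟨0, measure_ne_top _ _⟩
      _ ≤ μ (f ⁻¹' (h '' K)) := by
          rw [← Set.preimage_iInter]
          exact measure_mono (Set.preimage_mono hsub)
  have hgK : IsCompact (g '' K) := hKc.image hg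
  let Z : (ℕ → ℝ) → ℝ≥0 := fun y => sInf {t | (t, y) ∈ g '' K}
  have hsec : ∀ y, IsCompact {t | (t, y) ∈ g '' K} := fun y => by
    have : {t | (t, y) ∈ g '' K} = Prod.fst '' (g '' K ∩ (Set.univ ×ˢ {y})) := by
      ext t
      simp only [Set.mem_ofPred_eq, Set.mem_image (f := Prod.fst), Set.mem_inter_iff,
        Set.mem_prod, Set.mem_univ, true_and, Set.mem_singleton_iff, Prod.exists]
      constructor
      · intro ht; exact ⟨t, y, ⟨ht, rfl⟩, rfl⟩
      · rintro ⟨t, y, ⟨ht, rfl⟩, rfl⟩; exact ht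
    rw [this]
    exact (hgK.inter_right (isClosed_univ.prod isClosed_singleton)).image continuous_fst
  have hZmem : ∀ y ∈ h '' K, (Z y, y) ∈ g '' K := by
    rintro y ⟨x, hx, rfl⟩
    exact (hsec (h x)).sInf_mem ⟨(g x).1, x, hx, rfl⟩
  have hZm : Measurable Z := by
    refine measurable_of_Iic fun a => ?_
    have : Z ⁻¹' Set.Iic a = (Prod.snd '' (g '' K ∩ (Set.Iic a ×ˢ Set.univ))) ∪ (h '' K)ᶜ := by
      ext y
      simp only [Set.mem_preimage, Set.mem_Iic, Set.mem_union, Set.mem_compl_iff]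
      constructor
      · intro hy
        by_cases hyK : y ∈ h '' K
        · left; exact ⟨(Z y, y), ⟨hZmem y hyK, hy, trivial⟩, rfl⟩
        · exact Or.inr hyK
      · rintro (⟨⟨t, y'⟩, ⟨h1, h2, -⟩, rfl⟩ | hy)
        · exact le_trans (csInf_le (OrderBot.bddBelow {t | (t, y') ∈ g '' K}) h1) h2
        · have : {t | (t, y) ∈ g '' K} = ∅ := by
            ext t
            simp only [Set.mem_ofPred_eq, Set.mem_empty_iff_false, iff_false]
            rintro ⟨x, hx, hxe⟩
            exact hy ⟨x, hx, by simp [hh, hxe]⟩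
          simp only [Z]
          rw [this]; simp
    rw [this]
    refine MeasurableSet.union ?_ (hKc.image hhc).isClosed.measurableSet.compl
    exact ((hgK.inter_right (isClosed_Iic.prod isClosed_univ)).image
      continuous_snd).isClosed.measurableSet
  refine ⟨fun ω => Z (f ω), hZm.comp hf, ?_⟩
  refine ((hc0.trans_le hcK).trans_le (measure_mono ?_)).ne'
  intro ω hω
  obtain ⟨x, hx, hxe⟩ := hZmem _ hω
  exact ⟨x, hxe⟩

end

section
variable {Ω : Type*} [mΩ : MeasurableSpace Ω] {μ : Measure Ω} {ℱ : Filtration ℝ≥0 mΩ}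

lemma op_rc (hUC : UsualConditions μ ℱ) {t : ℝ≥0} {A : Set Ω}
    (h : ∀ s > t, MeasurableSet[ℱ s] A) : MeasurableSet[ℱ t] A := by
  rw [hUC.1 t]
  simp only [MeasurableSpace.measurableSet_iInf]
  exact h

lemma op_le_of_lt (hUC : UsualConditions μ ℱ) {T : Ω → ℝ≥0∞} {A : Set Ω}
    (h : ∀ t : ℝ≥0, MeasurableSet[ℱ t] {ω | T ω < t ∧ ω ∈ A}) (t : ℝ≥0) :
    MeasurableSet[ℱ t] {ω | T ω ≤ t ∧ ω ∈ A} := by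
  refine op_rc hUC fun s hs => ?_
  obtain ⟨u, -, hu, hlim⟩ := exists_seq_strictAnti_tendsto' hs
  have : {ω | T ω ≤ t ∧ ω ∈ A} = ⋂ n, {ω | T ω < u n ∧ ω ∈ A} := by
    ext ω
    simp only [Set.mem_ofPred_eq, Set.mem_iInter]
    constructor
    · rintro ⟨h1, h2⟩ n
      exact ⟨h1.trans_lt (by exact_mod_cast (hu n).1), h2⟩
    · intro h1
      refine ⟨?_, (h1 0).2⟩
      refine ge_of_tendsto' ((ENNReal.continuous_coe.tendsto t).comp hlim) fun n => (h1 n).1.le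
  rw [this]
  exact MeasurableSet.iInter fun n => ℱ.mono (hu n).2.le _ (h (u n))

lemma op_stop_of_lt (hUC : UsualConditions μ ℱ) {T : Ω → ℝ≥0∞}
    (h : ∀ t : ℝ≥0, MeasurableSet[ℱ t] {ω | T ω < t}) : IsStopTime ℱ T := by
  intro t
  simpa using op_le_of_lt hUC (T := T) (A := Set.univ) (by simpa using h) t

lemma op_min_meas {T : Ω → ℝ≥0∞} (hT : IsStopTime ℱ T) (t : ℝ≥0) :
    Measurable[ℱ t] fun ω => min (T ω) t := by
  refine measurable_of_Iic fun a => ?_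
  rcases le_or_gt (t : ℝ≥0∞) a with ha | ha
  · convert MeasurableSet.univ using 1
    ext ω; simp [ha]
  · lift a to ℝ≥0 using (ha.trans ENNReal.coe_lt_top).ne
    have : (fun ω => min (T ω) (t : ℝ≥0∞)) ⁻¹' Set.Iic (a : ℝ≥0∞) = {ω | T ω ≤ a} := by
      ext ω; simp [not_le.2 (by exact_mod_cast ha : a < t)]
    rw [this]
    exact ℱ.mono (by exact_mod_cast ha.le) _ (hT a)

lemma op_lt_meas {T : Ω → ℝ≥0∞} (hT : IsStopTime ℱ T) (t : ℝ≥0) :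
    MeasurableSet[ℱ t] {ω | T ω < t} := by
  have : {ω | T ω < t} = (fun ω => min (T ω) t) ⁻¹' Set.Iio (t : ℝ≥0∞) := by
    ext ω; simp
  rw [this]
  exact op_min_meas hT t measurableSet_Iio

/-- dyadic numbers -/
def opDy (n k : ℕ) : ℝ≥0 := k / 2 ^ n

/-- dyadic approximation from above -/
def opDd (n : ℕ) (x : ℝ≥0) : ℝ≥0 := opDy n (⌊x * 2 ^ n⌋₊ + 1)

lemma op_lt_dd (n : ℕ) (x : ℝ≥0) : x < opDd n x := by
  unfold opDd opDy
  rw [lt_div_iff₀ (by positivity)]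
  push_cast
  exact Nat.lt_floor_add_one _

lemma op_dd_le (n : ℕ) (x : ℝ≥0) : opDd n x ≤ x + (1 / 2) ^ n := by
  unfold opDd opDy
  rw [div_le_iff₀ (by positivity), add_mul, ← mul_pow]
  push_cast
  norm_num
  exact Nat.floor_le (by positivity)

lemma op_dd_tendsto (x : ℝ≥0) : Tendsto (fun n => opDd n x) atTop (nhds x) := by
  have h : Tendsto (fun n : ℕ => x + (1 / 2 : ℝ≥0) ^ n) atTop (nhds (x + 0)) :=
    tendsto_const_nhds.add (NNReal.tendsto_pow_atTop_nhds_zero_of_lt_one (by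
      rw [← NNReal.coe_lt_coe]; norm_num))
  rw [add_zero] at h
  exact tendsto_of_tendsto_of_tendsto_of_le_of_le tendsto_const_nhds h
    (fun n => (op_lt_dd n x).le) (fun n => op_dd_le n x)

/-- right-continuous adapted process -/
def OpRC (ℱ : Filtration ℝ≥0 mΩ) (X : ℝ≥0 → Ω → ℝ) : Prop :=
  (∀ ω, ∀ t : ℝ≥0, ContinuousWithinAt (fun s => X s ω) (Set.Ici t) t) ∧
  (∀ t, Measurable[ℱ t] (X t))

lemma op_stop_meas_rc {X : ℝ≥0 → Ω → ℝ} (hX : OpRC ℱ X) {T : Ω → ℝ≥0∞}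
    (hT : IsStopTime ℱ T) (t : ℝ≥0) :
    Measurable[ℱ t] ({ω | T ω < t}.indicator fun ω => X (T ω).toNNReal ω) := by
  classical
  let K : ℕ → Ω → ℕ := fun n ω => ⌊(min (T ω) t).toNNReal * 2 ^ n⌋₊
  have hK : ∀ n, Measurable[ℱ t] (K n) := by
    intro n
    refine Nat.measurable_floor.comp ?_
    exact (ENNReal.measurable_toNNReal.comp (op_min_meas hT t)).mul_const _
  let F : ℕ → ℕ × Ω → ℝ := fun n p => if opDy n (p.1 + 1) < t then X (opDy n (p.1 + 1)) p.2 else 0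
  have hF : ∀ n, @Measurable _ _ (@Prod.instMeasurableSpace ℕ Ω _ (ℱ t)) _ (F n) := by
    intro n
    refine @measurable_from_prod_countable_right ℕ Ω ℝ _ (ℱ t) _ _ _ _ fun k => ?_
    simp only [F]
    by_cases hk : opDy n (k + 1) < t
    · simp only [hk, if_true]
      exact (hX.2 _).mono (ℱ.mono hk.le) le_rfl
    · simp only [hk, if_false]
      exact measurable_const
  have hG : ∀ n, Measurable[ℱ t] fun ω => F n (K n ω, ω) := fun n =>
    (hF n).comp ((hK n).prodMk measurable_id)
  refine @measurable_of_tendsto_metrizable _ _ (ℱ t) _ _ _ _ (fun n ω => F n (K n ω, ω)) _ hG ?_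
  rw [tendsto_pi_nhds]
  intro ω
  by_cases hω : T ω < t
  · have hfin : T ω ≠ ∞ := (hω.trans ENNReal.coe_lt_top).ne
    have hmin : min (T ω) t = T ω := min_eq_left hω.le
    rw [Set.indicator_of_mem (show ω ∈ {ω | T ω < t} from hω)]
    have hlt : (T ω).toNNReal < t := by
      rw [← ENNReal.coe_lt_coe, ENNReal.coe_toNNReal hfin]; exact hω
    have h1 := op_dd_tendsto (T ω).toNNReal
    have h2 : Tendsto (fun n => opDd n (T ω).toNNReal) atTop
        (nhdsWithin (T ω).toNNReal (Set.Ici (T ω).toNNReal)) :=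
      tendsto_nhdsWithin_iff.2 ⟨h1, Eventually.of_forall fun n => (op_lt_dd n _).le⟩
    have h3 := (hX.1 ω (T ω).toNNReal).tendsto.comp h2
    refine h3.congr' ?_
    filter_upwards [h1.eventually (gt_mem_nhds hlt)] with n hn
    simp only [F, K, hmin]
    rw [if_pos (show opDy n (⌊(T ω).toNNReal * 2 ^ n⌋₊ + 1) < t from hn)]
    rfl
  · rw [Set.indicator_of_notMem (show ω ∉ {ω | T ω < t} from hω)]
    have hmin : min (T ω) t = t := min_eq_right (not_lt.1 hω)
    refine tendsto_const_nhds.congr fun n => ?_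
    simp only [F, K, hmin]
    rw [if_neg]
    simp only [ENNReal.toNNReal_coe, not_lt]
    exact (op_lt_dd n t).le

lemma op_optional_section {T : Ω → ℝ≥0∞} (hT : IsStopTime ℱ T) {H : Set (ℝ≥0 × Ω)}
    (hH : MeasurableSet[optionalSigma ℱ] H) (t : ℝ≥0) :
    MeasurableSet[ℱ t] {ω | T ω < t ∧ ((T ω).toNNReal, ω) ∈ H} := by
  let m' : MeasurableSpace (ℝ≥0 × Ω) :=
    { MeasurableSet' := fun H => MeasurableSet[ℱ t] {ω | T ω < t ∧ ((T ω).toNNReal, ω) ∈ H}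
      measurableSet_empty := by simp
      measurableSet_compl := fun A hA => by
        have : {ω | T ω < t ∧ ((T ω).toNNReal, ω) ∈ Aᶜ} =
            {ω | T ω < t} \ {ω | T ω < t ∧ ((T ω).toNNReal, ω) ∈ A} := by
          ext ω; simp only [Set.mem_ofPred_eq, Set.mem_compl_iff, Set.mem_sdiff]; tauto
        rw [this]
        exact (op_lt_meas hT t).diff hA
      measurableSet_iUnion := fun f hf => by
        have : {ω | T ω < t ∧ ((T ω).toNNReal, ω) ∈ ⋃ i, f i} =
            ⋃ i, {ω | T ω < t ∧ ((T ω).toNNReal, ω) ∈ f i} := by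
          ext ω; simp
        rw [this]
        exact MeasurableSet.iUnion hf }
  have hle : optionalSigma ℱ ≤ m' := by
    refine iSup₂_le fun X hX => ?_
    rintro _ ⟨U, hU, rfl⟩
    have h1 := op_stop_meas_rc (X := X) ⟨hX.1, hX.2.2⟩ hT t
    change MeasurableSet[ℱ t] _
    have : {ω | T ω < t ∧ ((T ω).toNNReal, ω) ∈ (fun p : ℝ≥0 × Ω => X p.1 p.2) ⁻¹' U} =
        {ω | T ω < t} ∩ ({ω | T ω < t}.indicator fun ω => X (T ω).toNNReal ω) ⁻¹' U := by
      ext ω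
      simp only [Set.mem_ofPred_eq, Set.mem_inter_iff, Set.mem_preimage]
      refine and_congr_right fun hω => ?_
      rw [Set.indicator_of_mem (show ω ∈ {ω | T ω < t} from hω)]
    rw [this]
    refine (op_lt_meas hT t).inter (h1 ?_)
    rwa [BorelSpace.measurable_eq (α := ℝ)]
  exact hle _ hH

lemma op_sigmaAt_le {T : Ω → ℝ≥0∞} (hT : IsStopTime ℱ T) : sigmaAt ℱ T hT ≤ mΩ := by
  intro A hA
  exact (iSup_le fun t => ℱ.le t : (⨆ t : ℝ≥0, (ℱ t : MeasurableSpace Ω)) ≤ mΩ) A hA.1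

lemma op_sigmaAt_of (hUC : UsualConditions μ ℱ) {T : Ω → ℝ≥0∞} (hT : IsStopTime ℱ T) {A : Set Ω}
    (hA : ∀ t : ℝ≥0, MeasurableSet[ℱ t] {ω | T ω < t ∧ ω ∈ A}) (hfin : ∀ ω ∈ A, T ω < ∞) :
    MeasurableSet[sigmaAt ℱ T hT] A := by
  refine ⟨?_, fun t => ?_⟩
  · have : A = ⋃ n : ℕ, {ω | T ω < ((n : ℝ≥0) : ℝ≥0∞) ∧ ω ∈ A} := by
      ext ω
      simp only [Set.mem_iUnion, Set.mem_ofPred_eq]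
      constructor
      · intro h
        obtain ⟨n, hn⟩ := ENNReal.exists_nat_gt (hfin ω h).ne
        exact ⟨n, by simpa using hn, h⟩
      · rintro ⟨_, _, h⟩; exact h
    rw [this]
    exact MeasurableSet.iUnion fun n =>
      (le_iSup (fun t : ℝ≥0 => (ℱ t : MeasurableSpace Ω)) (n : ℝ≥0)) _ (hA n)
  · have := op_le_of_lt hUC hA t
    convert this using 1
    ext ω; simp [and_comm]

lemma op_fin_meas (hUC : UsualConditions μ ℱ) {T : Ω → ℝ≥0∞} (hT : IsStopTime ℱ T) :
    MeasurableSet[sigmaAt ℱ T hT] {ω | T ω < ∞} := by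
  refine op_sigmaAt_of hUC hT (fun t => ?_) fun ω h => h
  convert op_lt_meas hT t using 1
  ext ω
  simp only [Set.mem_ofPred_eq, and_iff_left_iff_imp]
  exact fun h => h.trans ENNReal.coe_lt_top

lemma op_stopped_meas (hUC : UsualConditions μ ℱ) {T : Ω → ℝ≥0∞} (hT : IsStopTime ℱ T)
    {β : Type*} [MeasurableSpace β] [Zero β] {Y : ℝ≥0 × Ω → β}
    (hY : Measurable[optionalSigma ℱ] Y) :
    Measurable[sigmaAt ℱ T hT]
      ({ω | T ω < ∞}.indicator fun ω => Y ((T ω).toNNReal, ω)) := by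
  classical
  intro U hU
  have h1 : MeasurableSet[sigmaAt ℱ T hT] {ω | T ω < ∞ ∧ ((T ω).toNNReal, ω) ∈ Y ⁻¹' U} := by
    refine op_sigmaAt_of hUC hT (fun t => ?_) fun ω h => h.1
    convert op_optional_section hT (hY hU) t using 1
    ext ω
    simp only [Set.mem_ofPred_eq]
    constructor
    · rintro ⟨h1, h2, h3⟩; exact ⟨h1, h3⟩
    · rintro ⟨h1, h3⟩; exact ⟨h1, h1.trans ENNReal.coe_lt_top, h3⟩
  rw [Set.indicator_preimage, Set.ite]
  have e : (fun ω => Y ((T ω).toNNReal, ω)) ⁻¹' U ∩ {ω | T ω < ∞} =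
    {ω | T ω < ∞ ∧ ((T ω).toNNReal, ω) ∈ Y ⁻¹' U} := by
      ext ω; simp [and_comm]
  rw [e]
  refine MeasurableSet.union h1 (MeasurableSet.diff ?_ (op_fin_meas hUC hT))
  exact (@measurable_const _ _ _ (sigmaAt ℱ T hT) (0 : β)) hU

end

section
variable {Ω : Type*} [mΩ : MeasurableSpace Ω] {μ : Measure Ω} {ℱ : Filtration ℝ≥0 mΩ}

lemma op_rc_meas {X : ℝ≥0 → Ω → ℝ} (hX : OpRC ℱ X) : Measurable fun p : ℝ≥0 × Ω => X p.1 p.2 := by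
  have h1 : ∀ n, Measurable fun p : ℝ≥0 × Ω => X (opDd n p.1) p.2 := by
    intro n
    have h2 : Measurable fun q : ℕ × Ω => X (opDy n (q.1 + 1)) q.2 :=
      measurable_from_prod_countable_right fun k => (hX.2 (opDy n (k + 1))).mono (ℱ.le _) le_rfl
    exact h2.comp ((Nat.measurable_floor.comp (measurable_fst.mul_const _)).prodMk measurable_snd)
  refine measurable_of_tendsto_metrizable h1 ?_
  rw [tendsto_pi_nhds]
  rintro ⟨t, ω⟩
  have h2 : Tendsto (fun n => opDd n t) atTop (nhdsWithin t (Set.Ici t)) :=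
    tendsto_nhdsWithin_iff.2 ⟨op_dd_tendsto t, Eventually.of_forall fun n => (op_lt_dd n _).le⟩
  exact (hX.1 ω t).tendsto.comp h2

lemma op_opt_le : optionalSigma ℱ ≤ (Prod.instMeasurableSpace : MeasurableSpace (ℝ≥0 × Ω)) := by
  refine iSup₂_le fun X hX => ?_
  rintro _ ⟨U, hU, rfl⟩
  refine op_rc_meas (X := X) ⟨hX.1, hX.2.2⟩ ?_
  rwa [BorelSpace.measurable_eq (α := ℝ)]

lemma op_factor_opt {H : Set (ℝ≥0 × Ω)} (hH : MeasurableSet[optionalSigma ℱ] H) :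
    ∃ Φ : ℕ → ℝ≥0 → Ω → ℝ, (∀ n, OpRC ℱ (Φ n)) ∧ ∃ G : Set (ℕ → ℝ), MeasurableSet G ∧
      H = {p | (fun n => Φ n p.1 p.2) ∈ G} := by
  let m' : MeasurableSpace (ℝ≥0 × Ω) :=
    { MeasurableSet' := fun H => ∃ Φ : ℕ → ℝ≥0 → Ω → ℝ, (∀ n, OpRC ℱ (Φ n)) ∧
        ∃ G : Set (ℕ → ℝ), MeasurableSet G ∧ H = {p | (fun n => Φ n p.1 p.2) ∈ G}
      measurableSet_empty := ⟨fun _ _ _ => 0, fun n =>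
        ⟨fun _ _ => continuousWithinAt_const, fun _ => measurable_const⟩, ∅, .empty, by simp⟩
      measurableSet_compl := fun A ⟨Φ, hΦ, G, hG, e⟩ => ⟨Φ, hΦ, Gᶜ, hG.compl, by rw [e]; rfl⟩
      measurableSet_iUnion := fun f hf => by
        choose Φ hΦ G hG e using hf
        refine ⟨fun k => Φ k.unpair.1 k.unpair.2, fun k => hΦ _ _,
          ⋃ n, {x | (fun j => x (Nat.pair n j)) ∈ G n}, ?_, ?_⟩
        · refine MeasurableSet.iUnion fun n => ?_
          refine measurableSet_preimage (f := fun x : ℕ → ℝ => fun j => x (Nat.pair n j)) ?_ (hG n)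
          exact measurable_pi_lambda _ fun j => measurable_pi_apply _
        · ext p
          simp only [Set.mem_iUnion, Set.mem_ofPred_eq, Nat.unpair_pair]
          refine exists_congr fun n => ?_
          rw [e n]; rfl }
  have hle : optionalSigma ℱ ≤ m' := by
    refine iSup₂_le fun X hX => ?_
    rintro _ ⟨U, hU, rfl⟩
    refine ⟨fun _ => X, fun _ => ⟨hX.1, hX.2.2⟩, {x | x 0 ∈ U}, ?_, rfl⟩
    refine measurable_pi_apply (0 : ℕ) ?_
    rwa [BorelSpace.measurable_eq (α := ℝ)]
  exact hle _ hH

/-- hitting time of `{W < ε}` after `S`. -/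
def opHit (W : ℝ≥0 → Ω → ℝ) (S : Ω → ℝ≥0∞) (ε : ℝ) (ω : Ω) : ℝ≥0∞ :=
  ⨅ (t : ℝ≥0) (_ : S ω ≤ t ∧ W t ω < ε), (t : ℝ≥0∞)

lemma op_hit_stop (hUC : UsualConditions μ ℱ) {W : ℝ≥0 → Ω → ℝ} (hW : OpRC ℱ W)
    {S : Ω → ℝ≥0∞} (hS : IsStopTime ℱ S) (ε : ℝ) : IsStopTime ℱ (opHit W S ε) := by
  refine op_stop_of_lt hUC fun t => ?_
  obtain ⟨D, hDc, hDd⟩ := TopologicalSpace.exists_countable_dense ℝ≥0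
  have : {ω | opHit W S ε ω < t} =
      ⋃ q ∈ {q | q ∈ D ∧ q < t}, ({ω | S ω ≤ q} ∩ W q ⁻¹' Set.Iio ε) := by
    ext ω
    simp only [opHit, Set.mem_ofPred_eq, iInf_lt_iff, Set.mem_iUnion, Set.mem_inter_iff,
      Set.mem_preimage, Set.mem_Iio, exists_prop]
    constructor
    · rintro ⟨s, ⟨h1, h2⟩, h3⟩
      have h3' : s < t := by exact_mod_cast h3
      have h4 : ∀ᶠ u in nhdsWithin s (Set.Ici s), W u ω < ε :=
        (hW.1 ω s).eventually (gt_mem_nhds h2)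
      have h5 : ∀ᶠ u in nhdsWithin s (Set.Ioi s), W u ω < ε :=
        nhdsWithin_mono _ Set.Ioi_subset_Ici_self h4
      obtain ⟨u, hu, hu2⟩ := (mem_nhdsGT_iff_exists_Ioo_subset' h3').1 h5
      obtain ⟨q, hqD, hq1, hq2⟩ := hDd.exists_between (lt_min (show s < u from hu) h3')
      refine ⟨q, ⟨hqD, hq2.trans_le (min_le_right _ _)⟩, h1.trans (by exact_mod_cast hq1.le), ?_⟩
      exact hu2 ⟨hq1, hq2.trans_le (min_le_left _ _)⟩
    · rintro ⟨q, ⟨-, hq⟩, h1, h2⟩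
      exact ⟨q, ⟨h1, h2⟩, by exact_mod_cast hq⟩
  rw [this]
  refine MeasurableSet.biUnion (hDc.mono fun q hq => hq.1) fun q hq => ?_
  exact MeasurableSet.inter (ℱ.mono hq.2.le _ (hS q))
    (ℱ.mono hq.2.le _ (hW.2 q measurableSet_Iio))

lemma op_hit_ge {W : ℝ≥0 → Ω → ℝ} {S : Ω → ℝ≥0∞} (ε : ℝ) (ω : Ω) : S ω ≤ opHit W S ε ω :=
  le_iInf₂ fun _ h => h.1

lemma op_hit_val {W : ℝ≥0 → Ω → ℝ} (hW : OpRC ℱ W) {S : Ω → ℝ≥0∞} (ε : ℝ) {ω : Ω}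
    (h : opHit W S ε ω < ∞) : W (opHit W S ε ω).toNNReal ω ≤ ε := by
  by_contra! hcon
  set d := (opHit W S ε ω).toNNReal with hd
  have hde : opHit W S ε ω = d := (ENNReal.coe_toNNReal h.ne).symm
  have h4 : ∀ᶠ u in nhdsWithin d (Set.Ici d), ε < W u ω :=
    (hW.1 ω d).eventually (lt_mem_nhds hcon)
  obtain ⟨u, hu, hu2⟩ := mem_nhdsGE_iff_exists_Ico_subset.1 h4
  have : (u : ℝ≥0∞) ≤ opHit W S ε ω := by
    refine le_iInf₂ fun t ht => ?_
    by_contra! htu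
    have h5 : opHit W S ε ω ≤ t := iInf₂_le t ht
    rw [hde] at h5
    exact lt_asymm ht.2 (hu2 ⟨by exact_mod_cast h5, by exact_mod_cast htu⟩)
  rw [hde] at this
  exact absurd (show d < u from hu) (not_lt.2 (by exact_mod_cast this))

lemma op_zero_set (C : Set (ℕ → ℝ)) (hC : IsClosed C) (hne : C.Nonempty) :
    ∃ w : (ℕ → ℝ) → ℝ, Continuous w ∧ (∀ x, 0 ≤ w x) ∧ ∀ x, w x = 0 ↔ x ∈ C := by
  letI := TopologicalSpace.metrizableSpaceMetric (ℕ → ℝ)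
  exact ⟨fun x => Metric.infDist x C, Metric.continuous_infDist_pt C,
    fun x => Metric.infDist_nonneg, fun x => (hC.mem_iff_infDist_zero hne).symm⟩

lemma op_stop_measurable {T : Ω → ℝ≥0∞} (hT : IsStopTime ℱ T) : Measurable T := by
  refine measurable_of_Iic fun a => ?_
  rcases eq_or_ne a ∞ with rfl | ha
  · simp
  · lift a to ℝ≥0 using ha
    exact ℱ.le a _ (hT a)

/-- Optional section theorem (weak form). -/
lemma op_section [IsProbabilityMeasure μ] (hUC : UsualConditions μ ℱ) {H : Set (ℝ≥0 × Ω)}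
    (hH : MeasurableSet[optionalSigma ℱ] H) (hpos : μ {ω | ∃ t, (t, ω) ∈ H} ≠ 0) :
    ∃ T : Ω → ℝ≥0∞, IsStopTime ℱ T ∧ μ {ω | T ω < ∞ ∧ ((T ω).toNNReal, ω) ∈ H} ≠ 0 := by
  obtain ⟨Z, hZ, hZpos⟩ := op_meas_section μ (op_opt_le _ hH) hpos
  obtain ⟨Φ, hΦ, G, hG, rfl⟩ := op_factor_opt hH
  let ψ : Ω → (ℕ → ℝ) := fun ω n => Φ n (Z ω) ω
  have hψ : Measurable ψ := measurable_pi_lambda _ fun n =>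
    (op_rc_meas (hΦ n)).comp (hZ.prodMk measurable_id)
  have hν : μ.map ψ G ≠ 0 := by rw [Measure.map_apply hψ hG]; exact hZpos
  haveI : IsFiniteMeasure (μ.map ψ) := inferInstance
  obtain ⟨C, hCG, hC, hCpos⟩ := hG.exists_lt_isClosed_of_ne_top (measure_ne_top (μ.map ψ) G)
    (pos_iff_ne_zero.2 hν)
  have hCne : C.Nonempty := by
    rw [Set.nonempty_iff_ne_empty]; rintro rfl; simp at hCpos
  obtain ⟨w, hw, hw0, hwC⟩ := op_zero_set C hC hCne
  let W : ℝ≥0 → Ω → ℝ := fun t ω => w fun n => Φ n t ω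
  have hW : OpRC ℱ W := by
    refine ⟨fun ω t => ?_, fun t => ?_⟩
    · refine hw.continuousAt.comp_continuousWithinAt ?_
      exact continuousWithinAt_pi.2 fun n => (hΦ n).1 ω t
    · exact hw.measurable.comp (@measurable_pi_lambda _ _ _ (ℱ t) _ _ fun n => (hΦ n).2 t)
  let 𝒯 : Set (Ω → ℝ≥0∞) := {T | IsStopTime ℱ T ∧ ∀ᵐ ω ∂μ, ∀ t, W t ω = 0 → T ω ≤ t}
  let J : (Ω → ℝ≥0∞) → ℝ≥0∞ := fun T => ∫⁻ ω, (1 + T ω)⁻¹ ∂μ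
  have hne : (J '' 𝒯).Nonempty := ⟨_, fun _ => 0, ⟨fun t => by simp,
    Eventually.of_forall fun ω t _ => by simp⟩, rfl⟩
  obtain ⟨u, -, hu, hu𝒯⟩ := exists_seq_tendsto_sInf hne (OrderBot.bddBelow _)
  choose Tn hTn hJn using hu𝒯
  let T : Ω → ℝ≥0∞ := fun ω => ⨆ n, Tn n ω
  have hT : T ∈ 𝒯 := by
    refine ⟨fun t => ?_, ?_⟩
    · have : {ω | T ω ≤ t} = ⋂ n, {ω | Tn n ω ≤ t} := by
        ext ω; simp [T]
      rw [this]
      exact MeasurableSet.iInter fun n => (hTn n).1 t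
    · filter_upwards [ae_all_iff.2 fun n => (hTn n).2] with ω hω t ht
      exact iSup_le fun n => hω n t ht
  have hJT : J T ≤ sInf (J '' 𝒯) := by
    refine ge_of_tendsto' hu fun n => ?_
    rw [← hJn n]
    refine lintegral_mono fun ω => ?_
    exact ENNReal.inv_le_inv.2 (add_le_add le_rfl (le_iSup (fun n => Tn n ω) n))
  have hJtop : ∀ S, J S ≠ ∞ := by
    intro S
    refine ne_top_of_le_ne_top (b := ∫⁻ _, 1 ∂μ) (by simp) (lintegral_mono fun ω => ?_)
    simp
  have hD : ∀ n : ℕ, ∀ᵐ ω ∂μ, opHit W T (1 / (n + 1 : ℝ)) ω = T ω := by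
    intro n
    have hD𝒯 : opHit W T (1 / (n + 1 : ℝ)) ∈ 𝒯 := by
      refine ⟨op_hit_stop hUC hW hT.1 _, ?_⟩
      filter_upwards [hT.2] with ω hω t ht
      exact iInf₂_le t ⟨hω t ht, by rw [ht]; positivity⟩
    have h1 : (fun ω => (1 + opHit W T (1 / (n + 1 : ℝ)) ω)⁻¹) =ᵐ[μ] fun ω => (1 + T ω)⁻¹ := by
      refine ae_eq_of_ae_le_of_lintegral_le ?_ (hJtop _) ?_ ?_
      · refine Eventually.of_forall fun ω => ?_
        exact ENNReal.inv_le_inv.2 (add_le_add le_rfl (op_hit_ge _ _))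
      · exact ((op_stop_measurable hT.1).const_add 1).inv.aemeasurable
      · exact hJT.trans (sInf_le ⟨_, hD𝒯, rfl⟩)
    filter_upwards [h1] with ω hω
    exact (ENNReal.add_right_inj (by simp)).1 (inv_injective hω)
  have hval : ∀ᵐ ω ∂μ, T ω < ∞ → W (T ω).toNNReal ω = 0 := by
    filter_upwards [ae_all_iff.2 hD] with ω hω hfin
    refine le_antisymm ?_ (hw0 _)
    have h1 : ∀ n : ℕ, W (T ω).toNNReal ω ≤ 1 / (n + 1 : ℝ) := by
      intro n
      have := op_hit_val hW (S := T) (1 / (n + 1 : ℝ)) (ω := ω) (by rw [hω n]; exact hfin)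
      rwa [hω n] at this
    exact ge_of_tendsto' tendsto_one_div_add_atTop_nhds_zero_nat h1
  refine ⟨T, hT.1, fun h0 => ?_⟩
  have hinf : ∀ᵐ ω ∂μ, ¬ (T ω < ∞ ∧ (fun n => Φ n (T ω).toNNReal ω) ∈ G) := by
    rw [ae_iff]; simpa using h0
  rw [Measure.map_apply hψ hC.measurableSet] at hCpos
  refine hCpos.ne' ?_
  rw [← compl_compl (ψ ⁻¹' C)]
  change _ ∈ ae μ
  filter_upwards [hinf, hval, hT.2] with ω h1 h2 h3 h4
  have h5 : T ω < ∞ := (h3 (Z ω) ((hwC _).2 h4)).trans_lt ENNReal.coe_lt_top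
  exact h1 ⟨h5, hCG ((hwC _).1 (h2 h5))⟩

lemma op_gce_unique [IsFiniteMeasure μ] {G : MeasurableSpace Ω} (hG : G ≤ mΩ) {ξ η η' : Ω → ℝ}
    (hξ : SigmaIntegrable μ G ξ) (h : IsGCE μ G ξ η) (h' : IsGCE μ G ξ η') : η =ᵐ[μ] η' := by
  obtain ⟨s, hs, hsm, hsU, hsi⟩ := hξ
  let A : ℕ → Set Ω := fun n => s n ∩ ({ω | |η ω| ≤ n} ∩ {ω | |η' ω| ≤ n})
  have hA : ∀ n, MeasurableSet[G] (A n) := by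
    intro n
    refine MeasurableSet.inter (hs n) (MeasurableSet.inter ?_ ?_)
    · exact h.1 (measurableSet_Icc (a := -(n : ℝ)) (b := n)) |>.congr (by ext; simp [abs_le])
    · exact h'.1 (measurableSet_Icc (a := -(n : ℝ)) (b := n)) |>.congr (by ext; simp [abs_le])
  have hi : ∀ (n : ℕ) (f : Ω → ℝ), Measurable[G] f → (∀ ω ∈ A n, |f ω| ≤ n) →
      Integrable ((A n).indicator f) μ := by
    intro n f hf hb
    refine Integrable.of_bound (C := n)
      ((hf.indicator (hA n)).mono hG le_rfl).aestronglyMeasurable (Eventually.of_forall fun ω => ?_)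
    by_cases hω : ω ∈ A n
    · rw [Set.indicator_of_mem hω]; exact hb ω hω
    · rw [Set.indicator_of_notMem hω]; simp
  have key : ∀ n, (A n).indicator η =ᵐ[μ] (A n).indicator η' := by
    intro n
    have i1 := hi n η h.1 fun ω hω => hω.2.1
    have i2 := hi n η' h'.1 fun ω hω => hω.2.2
    refine ae_eq_of_forall_setIntegral_eq_of_sigmaFinite' hG (fun E _ _ => i1.integrableOn)
      (fun E _ _ => i2.integrableOn) (fun E hE _ => ?_) ?_ ?_
    · have hEA : MeasurableSet[G] (E ∩ A n) := MeasurableSet.inter hE (hA n)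
      have hint : Integrable ((E ∩ A n).indicator ξ) μ := by
        have : (E ∩ A n).indicator ξ = (E ∩ A n).indicator ((s n).indicator ξ) := by
          rw [Set.indicator_indicator]
          congr 1
          ext ω
          simp only [A, Set.mem_inter_iff]; tauto
        rw [this]
        exact (hsi n).indicator (hG _ hEA)
      rw [← integral_indicator (hG _ hE), ← integral_indicator (hG _ hE),
        Set.indicator_indicator, Set.indicator_indicator, ← h.2 _ hEA hint, ← h'.2 _ hEA hint]
    · exact (h.1.indicator (hA n)).stronglyMeasurable.aestronglyMeasurable
    · exact (h'.1.indicator (hA n)).stronglyMeasurable.aestronglyMeasurable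
  filter_upwards [ae_all_iff.2 key] with ω hω
  obtain ⟨k, hk⟩ := Set.mem_iUnion.1 (hsU.symm ▸ Set.mem_univ ω : ω ∈ ⋃ n, s n)
  obtain ⟨m, hm⟩ := exists_nat_ge (max |η ω| |η' ω|)
  have hmem : ω ∈ A (max k m) := by
    refine ⟨hsm (le_max_left _ _) hk, ?_, ?_⟩
    · exact (le_max_left _ _).trans (hm.trans (by exact_mod_cast le_max_right k m))
    · exact (le_max_right _ _).trans (hm.trans (by exact_mod_cast le_max_right k m))
  have := hω (max k m)
  rwa [Set.indicator_of_mem hmem, Set.indicator_of_mem hmem] at this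

lemma op_unique [IsProbabilityMeasure μ] (hUC : UsualConditions μ ℱ) {X Y Y' : ℝ≥0 → Ω → ℝ}
    (hX : MemLop μ ℱ X) (hY : IsOptProj μ ℱ X Y) (hY' : IsOptProj μ ℱ X Y') : Indist μ Y' Y := by
  by_contra hcon
  have hH : MeasurableSet[optionalSigma ℱ] {p : ℝ≥0 × Ω | Y' p.1 p.2 ≠ Y p.1 p.2} :=
    (measurableSet_eq_fun (m := optionalSigma ℱ) hY'.1 hY.1).compl
  have hpos : μ {ω | ∃ t, (t, ω) ∈ {p : ℝ≥0 × Ω | Y' p.1 p.2 ≠ Y p.1 p.2}} ≠ 0 := by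
    intro h0
    apply hcon
    rw [Indist, ae_iff]
    simpa using h0
  obtain ⟨T, hT, hTpos⟩ := op_section hUC hH hpos
  obtain ⟨η, hη, e⟩ := hY.2 T hT
  obtain ⟨η', hη', e'⟩ := hY'.2 T hT
  have h1 := op_gce_unique (op_sigmaAt_le hT) (hX.2 T hT) hη hη'
  apply hTpos
  have h2 : ∀ᵐ ω ∂μ, ¬ (T ω < ∞ ∧ Y' (T ω).toNNReal ω ≠ Y (T ω).toNNReal ω) := by
    filter_upwards [h1, e, e'] with ω h1 h2 h3 ⟨h4, h5⟩
    apply h5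
    rw [h1, h3] at h2
    simpa [stoppedVal, h4] using h2
  rw [ae_iff] at h2
  simpa using h2

end

section
/-- dyadic set -/
def opD : Set ℝ≥0 := {x | ∃ n k, x = opDy n k}

/-- chains of upcrossings -/
def opC (p : ℝ≥0 → ℝ) (a b : ℝ) : ℕ → ℝ≥0 → Prop
  | 0, _ => True
  | m + 1, y => ∃ x1 ∈ opD, ∃ y1 ∈ opD, x1 ≤ y1 ∧ y1 < y ∧ p x1 < a ∧ b < p y1 ∧ opC p a b m x1

lemma opC_mono {p : ℝ≥0 → ℝ} {a b : ℝ} {m : ℕ} {y y' : ℝ≥0} (h : y ≤ y') (hc : opC p a b m y) :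
    opC p a b m y' := by
  cases m with
  | zero => trivial
  | succ m =>
    obtain ⟨x1, h1, y1, h2, h3, h4, h5⟩ := hc
    exact ⟨x1, h1, y1, h2, h3, h4.trans_le h, h5⟩

lemma op_dyadic {x : ℝ≥0} (hx : x ∈ opD) : ∃ n0, ∀ n ≥ n0, ∃ k : ℕ, x = opDy n k := by
  obtain ⟨n0, k, rfl⟩ := hx
  refine ⟨n0, fun n hn => ?_⟩
  obtain ⟨d, rfl⟩ := Nat.exists_eq_add_of_le hn
  refine ⟨k * 2 ^ d, ?_⟩
  unfold opDy
  push_cast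
  rw [pow_add]
  field_simp

lemma op_c_up {Ω : Type*} {f : ℝ≥0 → Ω → ℝ} {ω : Ω} {a b : ℝ} (hab : a < b) (m : ℕ) :
    ∀ y, opC (fun t => f t ω) a b m y → ∃ n0, ∀ n ≥ n0, ∀ K : ℕ, y * 2 ^ n ≤ K →
      m ≤ upcrossingsBefore a b (fun k => f (opDy n k)) K ω := by
  induction m with
  | zero => exact fun y _ => ⟨0, fun _ _ _ _ => Nat.zero_le _⟩
  | succ m ih =>
    rintro y ⟨x1, h1, y1, h2, h3, h4, h5, h6, h7⟩
    obtain ⟨n0, hn0⟩ := ih x1 h7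
    obtain ⟨n1, hn1⟩ := op_dyadic h1
    obtain ⟨n2, hn2⟩ := op_dyadic h2
    refine ⟨max n0 (max n1 n2), fun n hn K hK => ?_⟩
    obtain ⟨N1, hN1⟩ := hn1 n (by omega)
    obtain ⟨N2, hN2⟩ := hn2 n (by omega)
    have hp : (0 : ℝ≥0) < 2 ^ n := by positivity
    have e1 : x1 * 2 ^ n = N1 := by rw [hN1, opDy]; field_simp
    have e2 : y1 * 2 ^ n = N2 := by rw [hN2, opDy]; field_simp
    have h8 : N1 ≤ N2 := by
      have : (N1 : ℝ≥0) ≤ N2 := by rw [← e1, ← e2]; gcongr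
      exact_mod_cast this
    have h9 : N2 + 1 ≤ K := by
      have : (N2 : ℝ≥0) < K := by rw [← e2]; refine lt_of_lt_of_le ?_ hK; gcongr
      exact_mod_cast this
    have h10 := hn0 n (by omega) N1 e1.le
    have h11 := upcrossingsBefore_lt_of_exists_upcrossing (f := fun k => f (opDy n k)) (ω := ω)
      hab (le_refl N1) (by simpa [← hN1] using h5) h8 (by simpa [← hN2] using h6)
    have h12 := upcrossingsBefore_mono (f := fun k => f (opDy n k)) hab h9 ω
    simp only at h12
    omega

/-- good paths -/
def opGood (p : ℝ≥0 → ℝ) : Prop :=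
  (∀ x ∈ opD, 0 ≤ p x ∧ p x ≤ 1) ∧
  ∀ a b : ℚ, a < b → ∀ N : ℕ, ∃ m, ¬ opC p a b m N

lemma op_good_lim {p : ℝ≥0 → ℝ} (hp : opGood p) {l : Filter ℝ≥0} (hl : ∀ᶠ x in l, x ∈ opD)
    (H : ∀ a b : ℚ, a < b → (∃ᶠ x in l, p x < a) → (∃ᶠ x in l, b < p x) →
      ∃ N : ℕ, ∀ m, opC p a b m N) : ∃ c, Tendsto p l (nhds c) := by
  refine tendsto_of_no_upcrossings (Rat.isDenseEmbedding_coe_real.dense) ?_ ?_ ?_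
  · rintro _ ⟨a, rfl⟩ _ ⟨b, rfl⟩ hab ⟨h1, h2⟩
    have hab' : a < b := by exact_mod_cast hab
    obtain ⟨N, hN⟩ := H a b hab' h1 h2
    obtain ⟨m, hm⟩ := hp.2 a b hab' N
    exact hm (hN m)
  · exact ⟨1, eventually_map.2 (hl.mono fun x hx => (hp.1 x hx).2)⟩
  · exact ⟨0, eventually_map.2 (hl.mono fun x hx => (hp.1 x hx).1)⟩

lemma op_good_right {p : ℝ≥0 → ℝ} (hp : opGood p) (t : ℝ≥0) :
    ∃ c, Tendsto p (nhdsWithin t (opD ∩ Set.Ioi t)) (nhds c) := by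
  refine op_good_lim hp (eventually_nhdsWithin_of_forall fun x hx => hx.1) ?_
  intro a b hab h1 h2
  obtain ⟨N, hN⟩ := exists_nat_gt t
  refine ⟨N, fun m => ?_⟩
  have key : ∀ y > t, ∀ᶠ x in nhdsWithin t (opD ∩ Set.Ioi t), x ∈ opD ∧ t < x ∧ x < y := by
    intro y hy
    filter_upwards [self_mem_nhdsWithin, mem_nhdsWithin_of_mem_nhds (Iio_mem_nhds hy)]
      with x h3 h4 using ⟨h3.1, h3.2, h4⟩
  have : ∀ y > t, opC p a b m y := by
    induction m with
    | zero => exact fun _ _ => trivial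
    | succ m ih =>
      intro y hy
      obtain ⟨y1, h3, h4, h5, h6⟩ := (h2.and_eventually (key y hy)).exists
      obtain ⟨x1, k3, k4, k5, k6⟩ := (h1.and_eventually (key y1 h5)).exists
      exact ⟨x1, k4, y1, h4, k6.le, h6, k3, h3, ih x1 k5⟩
  exact this N hN

lemma op_good_left {p : ℝ≥0 → ℝ} (hp : opGood p) (t : ℝ≥0) (ht : 0 < t) :
    ∃ c, Tendsto p (nhdsWithin t (opD ∩ Set.Iio t)) (nhds c) := by
  refine op_good_lim hp (eventually_nhdsWithin_of_forall fun x hx => hx.1) ?_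
  intro a b hab h1 h2
  obtain ⟨N, hN⟩ := exists_nat_gt t
  refine ⟨N, fun m => ?_⟩
  have key : ∀ y < t, ∀ᶠ x in nhdsWithin t (opD ∩ Set.Iio t), x ∈ opD ∧ y < x ∧ x < t := by
    intro y hy
    filter_upwards [self_mem_nhdsWithin, mem_nhdsWithin_of_mem_nhds (Ioi_mem_nhds hy)]
      with x h3 h4 using ⟨h3.1, h4, h3.2⟩
  have : ∃ y < t, opC p a b m y := by
    induction m with
    | zero => exact ⟨0, ht, trivial⟩
    | succ m ih =>
      obtain ⟨y, hy, hc⟩ := ih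
      obtain ⟨x1, k3, k4, k5, k6⟩ := (h1.and_eventually (key y hy)).exists
      obtain ⟨y1, h3, h4, h5, h6⟩ := (h2.and_eventually (key x1 k6)).exists
      obtain ⟨z, hz, hz'⟩ := exists_between h6
      exact ⟨z, hz', x1, k4, y1, h4, h5.le, hz, k3, h3, opC_mono k5.le hc⟩
  obtain ⟨y, hy, hc⟩ := this
  exact opC_mono (hy.trans hN).le hc

/-- right regularisation -/
def opR (p : ℝ≥0 → ℝ) (t : ℝ≥0) : ℝ := limUnder (nhdsWithin t (opD ∩ Set.Ioi t)) p

lemma op_dd_mem (n : ℕ) (x : ℝ≥0) : opDd n x ∈ opD := ⟨n, _, rfl⟩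

lemma op_dd_tendsto_right (t : ℝ≥0) :
    Tendsto (fun n => opDd n t) atTop (nhdsWithin t (opD ∩ Set.Ioi t)) :=
  tendsto_nhdsWithin_iff.2 ⟨op_dd_tendsto t,
    Eventually.of_forall fun n => ⟨op_dd_mem n t, op_lt_dd n t⟩⟩

instance op_nebot (t : ℝ≥0) : NeBot (nhdsWithin t (opD ∩ Set.Ioi t)) :=
  (op_dd_tendsto_right t).neBot

lemma op_R_tendsto {p : ℝ≥0 → ℝ} (hp : opGood p) (t : ℝ≥0) :
    Tendsto p (nhdsWithin t (opD ∩ Set.Ioi t)) (nhds (opR p t)) :=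
  tendsto_nhds_limUnder (op_good_right hp t)

lemma op_R_mem {p : ℝ≥0 → ℝ} (hp : opGood p) {V : Set ℝ} (hV : IsClosed V) {s y : ℝ≥0}
    (hs : s < y) (h : ∀ x ∈ opD, s < x → x < y → p x ∈ V) : opR p s ∈ V := by
  refine hV.mem_of_tendsto (op_R_tendsto hp s) ?_
  filter_upwards [self_mem_nhdsWithin, mem_nhdsWithin_of_mem_nhds (Iio_mem_nhds hs)]
    with x h3 h4 using h x h3.1 h3.2 h4

lemma op_R_bdd {p : ℝ≥0 → ℝ} (hp : opGood p) (t : ℝ≥0) : opR p t ∈ Set.Icc (0 : ℝ) 1 :=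
  op_R_mem hp isClosed_Icc (lt_add_one t) fun x hx _ _ => hp.1 x hx

lemma op_R_rc {p : ℝ≥0 → ℝ} (hp : opGood p) (t : ℝ≥0) :
    ContinuousWithinAt (opR p) (Set.Ici t) t := by
  refine ((closed_nhds_basis (opR p t)).tendsto_right_iff).2 ?_
  rintro V ⟨hV, hVc⟩
  have h1 := (op_R_tendsto hp t).eventually hV
  rw [eventually_nhdsWithin_iff] at h1
  obtain ⟨y, hy, hy'⟩ := exists_Ico_subset_of_mem_nhds h1 ⟨t + 1, lt_add_one t⟩
  filter_upwards [self_mem_nhdsWithin, mem_nhdsWithin_of_mem_nhds (Iio_mem_nhds hy)] with s hs hs'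
  refine op_R_mem hp hVc hs' fun x hx h2 h3 => ?_
  have h4 : t < x := lt_of_le_of_lt hs h2
  exact hy' ⟨h4.le, h3⟩ ⟨hx, h4⟩

lemma op_R_ll {p : ℝ≥0 → ℝ} (hp : opGood p) (t : ℝ≥0) (ht : 0 < t) :
    ∃ l : ℝ, Tendsto (opR p) (nhdsWithin t (Set.Iio t)) (nhds l) := by
  obtain ⟨l, hl⟩ := op_good_left hp t ht
  refine ⟨l, ((closed_nhds_basis l).tendsto_right_iff).2 ?_⟩
  rintro V ⟨hV, hVc⟩
  have h1 := hl.eventually hV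
  rw [eventually_nhdsWithin_iff] at h1
  obtain ⟨y, hy, hy'⟩ := exists_Ioc_subset_of_mem_nhds h1 ⟨0, ht⟩
  filter_upwards [self_mem_nhdsWithin, mem_nhdsWithin_of_mem_nhds (Ioi_mem_nhds hy)] with s hs hs'
  refine op_R_mem hp hVc hs fun x hx h2 h3 => ?_
  exact hy' ⟨lt_trans hs' h2, h3.le⟩ ⟨hx, h3⟩

end

section
variable {Ω : Type*} [mΩ : MeasurableSpace Ω] {μ : Measure Ω} {ℱ : Filtration ℝ≥0 mΩ}

lemma op_dy_mono (n : ℕ) : Monotone (opDy n) := by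
  intro k l h
  unfold opDy
  gcongr

/-- discrete filtration -/
def opFil (ℱ : Filtration ℝ≥0 mΩ) (n : ℕ) : Filtration ℕ mΩ where
  seq k := ℱ (opDy n k)
  mono' _ _ h := ℱ.mono (op_dy_mono n h)
  le' _ := ℱ.le _

/-- the martingale of an event -/
def opM (μ : Measure Ω) (ℱ : Filtration ℝ≥0 mΩ) (Ξ : Set Ω) (t : ℝ≥0) : Ω → ℝ :=
  μ[Ξ.indicator (fun _ => (1 : ℝ)) | ℱ t]

lemma op_ind_int [IsProbabilityMeasure μ] {Ξ : Set Ω} (hΞ : MeasurableSet Ξ) :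
    Integrable (Ξ.indicator (fun _ => (1 : ℝ))) μ := (integrable_const 1).indicator hΞ

lemma op_M_bdd [IsProbabilityMeasure μ] {Ξ : Set Ω} (hΞ : MeasurableSet Ξ) (t : ℝ≥0) :
    ∀ᵐ ω ∂μ, 0 ≤ opM μ ℱ Ξ t ω ∧ opM μ ℱ Ξ t ω ≤ 1 := by
  have h1 : 0 ≤ᵐ[μ] opM μ ℱ Ξ t :=
    condExp_nonneg (Eventually.of_forall fun ω => Set.indicator_nonneg (fun _ _ => zero_le_one) ω)
  have h2 : opM μ ℱ Ξ t ≤ᵐ[μ] μ[fun _ => (1 : ℝ) | ℱ t] :=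
    condExp_mono (op_ind_int hΞ) (integrable_const 1)
      (Eventually.of_forall fun ω => Set.indicator_le_self' (fun _ _ => zero_le_one) ω)
  rw [condExp_const (ℱ.le t)] at h2
  filter_upwards [h1, h2] with ω h1 h2 using ⟨h1, h2⟩

lemma op_M_sub [IsProbabilityMeasure μ] (Ξ : Set Ω) (n : ℕ) :
    Martingale (fun k => opM μ ℱ Ξ (opDy n k)) (opFil ℱ n) μ :=
  martingale_condExp _ (opFil ℱ n) μ

lemma op_up_bound [IsProbabilityMeasure μ] {Ξ : Set Ω} (hΞ : MeasurableSet Ξ) {a b : ℝ}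
    (hab : a < b) (n K : ℕ) :
    ∫⁻ ω, (upcrossingsBefore a b (fun k => opM μ ℱ Ξ (opDy n k)) K ω : ℝ≥0∞) ∂μ ≤
      ENNReal.ofReal ((1 + |a|) / (b - a)) := by
  have hm := op_M_sub (μ := μ) (ℱ := ℱ) Ξ n
  have h1 := hm.submartingale.mul_integral_upcrossingsBefore_le_integral_pos_part a b K
  have h2 : ∫ ω, (opM μ ℱ Ξ (opDy n K) ω - a)⁺ ∂μ ≤ ∫ ω, (1 + |a|) ∂μ := by
    refine integral_mono_ae ?_ (integrable_const _) ?_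
    · exact ((hm.integrable K).sub (integrable_const a)).pos_part
    · filter_upwards [op_M_bdd (ℱ := ℱ) hΞ (opDy n K)] with ω hω
      refine max_le ?_ (by positivity)
      linarith [neg_abs_le a]
  simp only [integral_const, probReal_univ, one_smul] at h2
  have h3 := hm.stronglyAdapted.integrable_upcrossingsBefore (μ := μ) (N := K) hab
  have h4 : ∫⁻ ω, (upcrossingsBefore a b (fun k => opM μ ℱ Ξ (opDy n k)) K ω : ℝ≥0∞) ∂μ =
      ENNReal.ofReal (∫ ω, (upcrossingsBefore a b (fun k => opM μ ℱ Ξ (opDy n k)) K ω : ℝ) ∂μ) := by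
    rw [ofReal_integral_eq_lintegral_ofReal h3 (Eventually.of_forall fun ω => Nat.cast_nonneg _)]
    simp
  rw [h4]
  refine ENNReal.ofReal_le_ofReal ?_
  rw [le_div_iff₀ (by linarith), mul_comm]
  exact h1.trans h2

lemma op_ae_good [IsProbabilityMeasure μ] {Ξ : Set Ω} (hΞ : MeasurableSet Ξ) :
    ∀ᵐ ω ∂μ, opGood (fun t => opM μ ℱ Ξ t ω) := by
  have h1 : ∀ᵐ ω ∂μ, ∀ n k : ℕ, 0 ≤ opM μ ℱ Ξ (opDy n k) ω ∧ opM μ ℱ Ξ (opDy n k) ω ≤ 1 :=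
    ae_all_iff.2 fun n => ae_all_iff.2 fun k => op_M_bdd hΞ _
  have h2 : ∀ᵐ ω ∂μ, ∀ a b : ℚ, a < b → ∀ N : ℕ, ∃ m, ¬ opC (fun t => opM μ ℱ Ξ t ω) a b m N := by
    refine ae_all_iff.2 fun a => ae_all_iff.2 fun b => eventually_imp_distrib_left.2 fun hab =>
      ae_all_iff.2 fun N => ?_
    have hab' : (a : ℝ) < b := by exact_mod_cast hab
    let u : ℕ → Ω → ℝ≥0∞ := fun n ω =>
      (upcrossingsBefore (a : ℝ) b (fun k => opM μ ℱ Ξ (opDy n k)) (N * 2 ^ n) ω : ℝ≥0∞)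
    have hu : ∀ n, Measurable (u n) := fun n => measurable_from_top.comp
      ((op_M_sub (μ := μ) (ℱ := ℱ) Ξ n).stronglyAdapted.measurable_upcrossingsBefore hab')
    have h3 : ∫⁻ ω, liminf (fun n => u n ω) atTop ∂μ ≤
        ENNReal.ofReal ((1 + |(a : ℝ)|) / (b - a)) := by
      refine (lintegral_liminf_le hu).trans ?_
      refine (liminf_le_liminf (v := fun _ => ENNReal.ofReal ((1 + |(a : ℝ)|) / (b - a)))
        (Eventually.of_forall fun n => op_up_bound hΞ hab' n (N * 2 ^ n))).trans ?_
      simp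
    have h4 := ae_lt_top (Measurable.liminf hu) (h3.trans_lt ENNReal.ofReal_lt_top).ne
    filter_upwards [h4] with ω hω
    by_contra hcon
    push Not at hcon
    refine hω.ne (ENNReal.eq_top_of_forall_nnreal_le fun r => ?_)
    obtain ⟨m, hm⟩ := exists_nat_ge r
    refine le_trans (b := (m : ℝ≥0∞)) (by exact_mod_cast hm) ?_
    obtain ⟨n0, hn0⟩ := op_c_up (f := opM μ ℱ Ξ) hab' m N (hcon m)
    refine le_liminf_of_le (by isBoundedDefault) ?_
    filter_upwards [eventually_ge_atTop n0] with n hn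
    have := hn0 n hn (N * 2 ^ n) (by push_cast; rfl)
    exact Nat.cast_le.2 this
  filter_upwards [h1, h2] with ω h1 h2
  refine ⟨?_, h2⟩
  rintro _ ⟨n, k, rfl⟩
  exact h1 n k

end

section
variable {Ω : Type*} [mΩ : MeasurableSpace Ω] {μ : Measure Ω} {ℱ : Filtration ℝ≥0 mΩ}

lemma op_cadlag_opt {X : ℝ≥0 → Ω → ℝ}
    (h1 : ∀ ω, ∀ t : ℝ≥0, ContinuousWithinAt (fun s => X s ω) (Set.Ici t) t)
    (h2 : ∀ ω, ∀ t : ℝ≥0, 0 < t →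
        ∃ l : ℝ, Filter.Tendsto (fun s => X s ω) (nhdsWithin t (Set.Iio t)) (nhds l))
    (h3 : ∀ t, Measurable[ℱ t] (X t)) :
    Measurable[optionalSigma ℱ] fun p : ℝ≥0 × Ω => X p.1 p.2 := by
  intro U hU
  refine (le_iSup₂_of_le (f := fun (X : ℝ≥0 → Ω → ℝ) _ =>
    MeasurableSpace.comap (fun p : ℝ≥0 × Ω => X p.1 p.2) (borel ℝ)) X ⟨h1, h2, h3⟩ le_rfl) _ ?_
  exact ⟨U, by rwa [← BorelSpace.measurable_eq (α := ℝ)], rfl⟩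

lemma op_fst_opt : Measurable[optionalSigma ℱ] (Prod.fst : ℝ≥0 × Ω → ℝ≥0) := by
  have h : Measurable[optionalSigma ℱ] fun p : ℝ≥0 × Ω => (p.1 : ℝ) := by
    refine op_cadlag_opt (X := fun t _ => (t : ℝ)) (fun ω t => ?_) (fun ω t _ => ⟨t, ?_⟩)
      fun t => measurable_const
    · exact NNReal.continuous_coe.continuousWithinAt
    · exact (NNReal.continuous_coe.tendsto t).mono_left nhdsWithin_le_nhds
  have := measurable_real_toNNReal.comp h
  simpa [Function.comp_def] using this

/-- slices by dyadic intervals -/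
def opB (T : Ω → ℝ≥0∞) (A : Set Ω) (n k : ℕ) : Set Ω :=
  (A ∩ {ω | T ω < ∞}) ∩ {ω | ⌊(T ω).toNNReal * 2 ^ n⌋₊ = k}

lemma op_B_meas {T : Ω → ℝ≥0∞} (hT : IsStopTime ℱ T) {A : Set Ω}
    (hA : MeasurableSet[sigmaAt ℱ T hT] A) (n k : ℕ) :
    MeasurableSet[ℱ (opDy n (k + 1))] (opB T A n k) := by
  have : opB T A n k = (A ∩ {ω | T ω ≤ opDy n (k + 1)}) ∩
      ({ω | T ω < opDy n (k + 1)} \ {ω | T ω < opDy n k}) := by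
    ext ω
    simp only [opB, Set.mem_inter_iff, Set.mem_ofPred_eq, Set.mem_sdiff, not_lt]
    by_cases hω : T ω = ∞
    · simp [hω]
    · lift T ω to ℝ≥0 using hω with x
      simp only [ENNReal.coe_lt_top, and_true, ENNReal.toNNReal_coe, ENNReal.coe_le_coe,
        ENNReal.coe_lt_coe]
      rw [Nat.floor_eq_iff (by positivity)]
      have h1 : opDy n k ≤ x ↔ (k : ℝ≥0) ≤ x * 2 ^ n := by
        rw [opDy, div_le_iff₀ (by positivity)]
      have h2 : x < opDy n (k + 1) ↔ x * 2 ^ n < (k : ℝ≥0) + 1 := by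
        rw [opDy, lt_div_iff₀ (by positivity)]; push_cast; rfl
      rw [h1, ← h2]
      have := @le_of_lt _ _ x (opDy n (k + 1))
      tauto
  rw [this]
  refine (hA.2 _).inter ((op_lt_meas hT _).diff ?_)
  exact ℱ.mono (op_dy_mono n (Nat.le_succ k)) _ (op_lt_meas hT _)

lemma op_B_int [IsProbabilityMeasure μ] {Ξ : Set Ω} (hΞ : MeasurableSet Ξ) {t : ℝ≥0} {B : Set Ω}
    (hB : MeasurableSet[ℱ t] B) :
    ∫⁻ ω in B, ENNReal.ofReal (opM μ ℱ Ξ t ω) ∂μ = μ (B ∩ Ξ) := by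
  have hB' := ℱ.le t _ hB
  have hi : Integrable (opM μ ℱ Ξ t) μ := integrable_condExp
  rw [← ofReal_integral_eq_lintegral_ofReal hi.integrableOn
    (ae_restrict_of_ae ((op_M_bdd hΞ t).mono fun ω h => h.1))]
  unfold opM
  rw [setIntegral_condExp (ℱ.le t) (op_ind_int hΞ) hB, integral_indicator hΞ]
  simp [Measure.real, Measure.restrict_apply, hΞ, Set.inter_comm]

lemma op_sample_dd [IsProbabilityMeasure μ] {Ξ : Set Ω} (hΞ : MeasurableSet Ξ)
    {T : Ω → ℝ≥0∞} (hT : IsStopTime ℱ T) {A : Set Ω}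
    (hA : MeasurableSet[sigmaAt ℱ T hT] A) (n : ℕ) :
    ∫⁻ ω in A ∩ {ω | T ω < ∞}, ENNReal.ofReal (opM μ ℱ Ξ (opDd n (T ω).toNNReal) ω) ∂μ =
      μ (A ∩ {ω | T ω < ∞} ∩ Ξ) := by
  have hBm : ∀ k, MeasurableSet (opB T A n k) := fun k => ℱ.le _ _ (op_B_meas hT hA n k)
  have hU : A ∩ {ω | T ω < ∞} = ⋃ k, opB T A n k := by
    ext ω; simp [opB]
  have hd : Pairwise (Function.onFun Disjoint (opB T A n)) := by
    intro k l hkl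
    refine Set.disjoint_left.2 fun ω h1 h2 => hkl (h1.2.symm.trans h2.2)
  rw [hU, lintegral_iUnion hBm hd, Set.iUnion_inter, measure_iUnion
    (fun k l hkl => (hd hkl).mono Set.inter_subset_left Set.inter_subset_left)
    fun k => (hBm k).inter hΞ]
  congr 1
  ext k
  rw [← op_B_int hΞ (op_B_meas hT hA n k)]
  refine setLIntegral_congr_fun (hBm k) fun ω hω => ?_
  have : opDd n (T ω).toNNReal = opDy n (k + 1) := by rw [opDd, hω.2]
  simp only [this]

lemma op_M_meas (Ξ : Set Ω) (t : ℝ≥0) : Measurable (opM μ ℱ Ξ t) :=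
  (stronglyMeasurable_condExp.mono (ℱ.le t)).measurable

lemma op_M_dd_meas (Ξ : Set Ω) {T : Ω → ℝ≥0∞} (hTm : Measurable T) (n : ℕ) :
    Measurable fun ω => opM μ ℱ Ξ (opDd n (T ω).toNNReal) ω := by
  have h2 : Measurable fun q : ℕ × Ω => opM μ ℱ Ξ (opDy n (q.1 + 1)) q.2 :=
    measurable_from_prod_countable_right fun k => op_M_meas Ξ (opDy n (k + 1))
  have h4 : Measurable fun ω => (T ω).toNNReal * 2 ^ n :=
    (ENNReal.measurable_toNNReal.comp hTm).mul_const _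
  have h5 : Measurable fun ω => ⌊(T ω).toNNReal * 2 ^ n⌋₊ := Nat.measurable_floor.comp h4
  have h3 : Measurable fun ω => ((⌊(T ω).toNNReal * 2 ^ n⌋₊, ω) : ℕ × Ω) :=
    h5.prodMk measurable_id
  have h6 := h2.comp h3
  unfold opDd
  exact h6

lemma op_event_proj [IsProbabilityMeasure μ] (hUC : UsualConditions μ ℱ) {Ξ : Set Ω}
    (hΞ : MeasurableSet Ξ) :
    ∃ Y : ℝ≥0 × Ω → ℝ, Measurable[optionalSigma ℱ] Y ∧
      ∀ (T : Ω → ℝ≥0∞) (hT : IsStopTime ℱ T) (A : Set Ω), MeasurableSet[sigmaAt ℱ T hT] A →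
        ∫⁻ ω in A ∩ {ω | T ω < ∞}, ENNReal.ofReal (Y ((T ω).toNNReal, ω)) ∂μ =
          μ (A ∩ {ω | T ω < ∞} ∩ Ξ) := by
  classical
  let N := toMeasurable μ {ω | ¬ opGood (fun t => opM μ ℱ Ξ t ω)}
  have hN0 : μ N = 0 := by
    rw [measure_toMeasurable]; exact ae_iff.1 (op_ae_good hΞ)
  have hNm : MeasurableSet N := measurableSet_toMeasurable _ _
  have hNF : ∀ t, MeasurableSet[ℱ t] N := fun t => ℱ.mono zero_le _ (hUC.2 N hNm hN0)
  have hgood : ∀ ω ∉ N, opGood (fun t => opM μ ℱ Ξ t ω) := by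
    intro ω hω
    by_contra h
    exact hω (subset_toMeasurable _ _ h)
  let Y : ℝ≥0 → Ω → ℝ := fun t => Nᶜ.indicator fun ω => opR (fun t => opM μ ℱ Ξ t ω) t
  have hYin : ∀ ω ∈ N, ∀ t, Y t ω = 0 := fun ω hω t =>
    Set.indicator_of_notMem (by simpa using hω) _
  have hYout : ∀ ω ∉ N, ∀ t, Y t ω = opR (fun t => opM μ ℱ Ξ t ω) t := fun ω hω t =>
    Set.indicator_of_mem (by simpa using hω) _
  have hlim : ∀ ω ∉ N, ∀ t, Tendsto (fun n => opM μ ℱ Ξ (opDd n t) ω) atTop (nhds (Y t ω)) := by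
    intro ω hω t
    rw [hYout ω hω t]
    exact (op_R_tendsto (hgood ω hω) t).comp (op_dd_tendsto_right t)
  have hYad : ∀ t, Measurable[ℱ t] (Y t) := by
    intro t U hU
    refine op_rc hUC fun s hs => ?_
    suffices Measurable[ℱ s] (Y t) from this hU
    let G : ℕ → Ω → ℝ := fun n =>
      if opDd n t ≤ s then Nᶜ.indicator (opM μ ℱ Ξ (opDd n t)) else fun _ => 0
    have hG : ∀ n, Measurable[ℱ s] (G n) := by
      intro n
      by_cases h : opDd n t ≤ s
      · simp only [G, h, if_true]
        refine Measurable.indicator ?_ (hNF s).compl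
        exact (stronglyMeasurable_condExp.measurable).mono (ℱ.mono h) le_rfl
      · simp only [G, h, if_false]
        exact measurable_const
    refine @measurable_of_tendsto_metrizable _ _ (ℱ s) _ _ _ _ G _ hG ?_
    rw [tendsto_pi_nhds]
    intro ω
    have hev := (op_dd_tendsto t).eventually (gt_mem_nhds hs)
    by_cases hω : ω ∈ N
    · rw [hYin ω hω]
      refine tendsto_const_nhds.congr' ?_
      filter_upwards [hev] with n hn
      simp [G, hn.le, hω]
    · refine (hlim ω hω t).congr' ?_
      filter_upwards [hev] with n hn
      simp [G, hn.le, hω]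
  refine ⟨fun p => Y p.1 p.2, op_cadlag_opt (fun ω t => ?_) (fun ω t ht => ?_) hYad, ?_⟩
  · by_cases hω : ω ∈ N
    · simp only [hYin ω hω]; exact continuousWithinAt_const
    · simp only [hYout ω hω]; exact op_R_rc (hgood ω hω) t
  · by_cases hω : ω ∈ N
    · simp only [hYin ω hω]; exact ⟨0, tendsto_const_nhds⟩
    · simp only [hYout ω hω]; exact op_R_ll (hgood ω hω) t ht
  · intro T hT A hA
    have hTm : Measurable T := op_stop_measurable hT
    have hNae : ∀ᵐ ω ∂μ, ω ∉ N := measure_eq_zero_iff_ae_notMem.1 hN0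
    have key := tendsto_lintegral_of_dominated_convergence (μ := μ.restrict (A ∩ {ω | T ω < ∞}))
      (F := fun n ω => ENNReal.ofReal (opM μ ℱ Ξ (opDd n (T ω).toNNReal) ω))
      (f := fun ω => ENNReal.ofReal (Y (T ω).toNNReal ω)) (fun _ => 1) ?_ ?_ ?_ ?_
    · simp only [op_sample_dd hΞ hT hA] at key
      exact tendsto_nhds_unique key tendsto_const_nhds
    · intro n
      exact ENNReal.measurable_ofReal.comp (op_M_dd_meas Ξ hTm n)
    · intro n
      refine ae_restrict_of_ae (hNae.mono fun ω hω => ?_)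
      exact ENNReal.ofReal_le_one.2 (((hgood ω hω).1 _ (op_dd_mem n _)).2)
    · simp
    · refine ae_restrict_of_ae (hNae.mono fun ω hω => ?_)
      exact ENNReal.tendsto_ofReal (hlim ω hω _)

end

section
variable {Ω : Type*} [mΩ : MeasurableSpace Ω] {μ : Measure Ω} {ℱ : Filtration ℝ≥0 mΩ}

/-- integral of a process sampled at a time on a set -/
def opI (μ : Measure Ω) (T : Ω → ℝ≥0∞) (A : Set Ω) (X : ℝ≥0 × Ω → ℝ≥0∞) : ℝ≥0∞ :=
  ∫⁻ ω in A ∩ {ω | T ω < ∞}, X ((T ω).toNNReal, ω) ∂μ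

/-- `Y` is a nonnegative optional projection of `X` -/
def opPr (μ : Measure Ω) (ℱ : Filtration ℝ≥0 mΩ) (X Y : ℝ≥0 × Ω → ℝ≥0∞) : Prop :=
  Measurable[optionalSigma ℱ] Y ∧ ∀ (T : Ω → ℝ≥0∞) (hT : IsStopTime ℱ T) (A : Set Ω),
    MeasurableSet[sigmaAt ℱ T hT] A → opI μ T A X = opI μ T A Y

lemma op_samp_meas {β : Type*} [MeasurableSpace β] {T : Ω → ℝ≥0∞} (hT : IsStopTime ℱ T)
    {X : ℝ≥0 × Ω → β} (hX : Measurable X) : Measurable fun ω => X ((T ω).toNNReal, ω) := by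
  have h : Measurable fun ω => (((T ω).toNNReal, ω) : ℝ≥0 × Ω) :=
    (ENNReal.measurable_toNNReal.comp (op_stop_measurable hT)).prodMk measurable_id
  exact hX.comp h

lemma op_opt_meas {β : Type*} [MeasurableSpace β] {Y : ℝ≥0 × Ω → β}
    (hY : Measurable[optionalSigma ℱ] Y) : Measurable Y := hY.mono op_opt_le le_rfl

lemma op_compare [IsProbabilityMeasure μ] (hUC : UsualConditions μ ℱ) {Y Z : ℝ≥0 × Ω → ℝ≥0∞}
    (hY : Measurable[optionalSigma ℱ] Y) (hZ : Measurable[optionalSigma ℱ] Z)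
    {T : Ω → ℝ≥0∞} (hT : IsStopTime ℱ T)
    (h : ∀ A, MeasurableSet[sigmaAt ℱ T hT] A → opI μ T A Y ≤ opI μ T A Z) :
    ∀ᵐ ω ∂μ, T ω < ∞ → Y ((T ω).toNNReal, ω) ≤ Z ((T ω).toNNReal, ω) := by
  have hm := op_sigmaAt_le hT
  have hY' := op_stopped_meas hUC hT hY
  have hZ' := op_stopped_meas hUC hT hZ
  have hF : MeasurableSet {ω | T ω < ∞} := hm _ (op_fin_meas hUC hT)
  have key := ae_le_of_forall_setLIntegral_le_of_sigmaFinite (μ := μ.trim hm) hY'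
    (g := {ω | T ω < ∞}.indicator fun ω => Z ((T ω).toNNReal, ω)) (fun s hs _ => by
      rw [setLIntegral_trim hm hY' hs, setLIntegral_trim hm hZ' hs, lintegral_indicator hF,
        lintegral_indicator hF, Measure.restrict_restrict hF, Set.inter_comm]
      exact h s hs)
  filter_upwards [ae_of_ae_trim hm key] with ω hω hfin
  simpa [hfin] using hω

lemma op_opI_set {T : Ω → ℝ≥0∞} (hT : IsStopTime ℱ T) (A : Set Ω) {S : Set (ℝ≥0 × Ω)}
    (hS : MeasurableSet S) : opI μ T A (S.indicator fun _ => 1) =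
      μ ({ω | ((T ω).toNNReal, ω) ∈ S} ∩ (A ∩ {ω | T ω < ∞})) := by
  unfold opI
  have hm : MeasurableSet {ω | ((T ω).toNNReal, ω) ∈ S} :=
    op_samp_meas hT (X := fun p => p) measurable_id hS
  rw [← Measure.restrict_apply hm, ← lintegral_indicator_one hm]
  rfl

lemma op_pr_rect [IsProbabilityMeasure μ] (hUC : UsualConditions μ ℱ) {I : Set ℝ≥0} {Ξ : Set Ω}
    (hI : MeasurableSet I) (hΞ : MeasurableSet Ξ) :
    ∃ Y, opPr μ ℱ ((I ×ˢ Ξ).indicator fun _ => 1) Y := by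
  classical
  obtain ⟨M, hM, hMT⟩ := op_event_proj hUC hΞ
  have hS : MeasurableSet[optionalSigma ℱ] (Prod.fst ⁻¹' I : Set (ℝ≥0 × Ω)) := op_fst_opt hI
  refine ⟨(Prod.fst ⁻¹' I).indicator fun p => ENNReal.ofReal (M p), ?_, ?_⟩
  · exact Measurable.indicator (ENNReal.measurable_ofReal.comp hM) hS
  · intro T hT A hA
    have hm := op_sigmaAt_le hT
    rw [op_opI_set hT A (hI.prod hΞ)]
    have h1 := op_stopped_meas hUC hT
      (Y := (Prod.fst ⁻¹' I : Set (ℝ≥0 × Ω)).indicator fun _ => (1 : ℝ≥0∞))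
      (Measurable.indicator measurable_const hS)
    have h2 := h1 (measurableSet_singleton 1)
    have h3 := hMT T hT _ (hA.inter h2)
    have hC : A ∩ ({ω | T ω < ∞}.indicator fun ω =>
        (Prod.fst ⁻¹' I : Set (ℝ≥0 × Ω)).indicator (fun _ => (1 : ℝ≥0∞)) ((T ω).toNNReal, ω)) ⁻¹' {1}
        ∩ {ω | T ω < ∞} = {ω | (T ω).toNNReal ∈ I} ∩ (A ∩ {ω | T ω < ∞}) := by
      ext ω
      by_cases h4 : T ω < ∞ <;> by_cases h5 : (T ω).toNNReal ∈ I <;> simp [h4, h5, Set.indicator]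
    rw [hC] at h3
    have hIm : MeasurableSet {ω | (T ω).toNNReal ∈ I} :=
      (ENNReal.measurable_toNNReal.comp (op_stop_measurable hT)) hI
    have h6 : opI μ T A ((Prod.fst ⁻¹' I).indicator fun p => ENNReal.ofReal (M p)) =
        ∫⁻ ω in {ω | (T ω).toNNReal ∈ I} ∩ (A ∩ {ω | T ω < ∞}),
          ENNReal.ofReal (M ((T ω).toNNReal, ω)) ∂μ := by
      rw [← Measure.restrict_restrict hIm, ← lintegral_indicator hIm]
      rfl
    rw [h6, h3]
    congr 1
    ext ω
    simp only [Set.mem_inter_iff, Set.mem_ofPred_eq, Set.mem_prod]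
    tauto

lemma op_opI_one (T : Ω → ℝ≥0∞) (A : Set Ω) :
    opI μ T A (fun _ => 1) = μ (A ∩ {ω | T ω < ∞}) := by
  simp [opI]

lemma op_opI_add {T : Ω → ℝ≥0∞} (hT : IsStopTime ℱ T) (A : Set Ω) {X Y : ℝ≥0 × Ω → ℝ≥0∞}
    (hX : Measurable X) : opI μ T A (fun p => X p + Y p) = opI μ T A X + opI μ T A Y :=
  lintegral_add_left (op_samp_meas hT hX) _

lemma op_opI_mono {T : Ω → ℝ≥0∞} (A : Set Ω) {X Y : ℝ≥0 × Ω → ℝ≥0∞}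
    (h : X ≤ Y) : opI μ T A X ≤ opI μ T A Y :=
  lintegral_mono fun _ => h _

lemma op_pr_compl [IsProbabilityMeasure μ] (hUC : UsualConditions μ ℱ) {S : Set (ℝ≥0 × Ω)}
    (hS : MeasurableSet S) {Y : ℝ≥0 × Ω → ℝ≥0∞} (hY : opPr μ ℱ (S.indicator fun _ => 1) Y) :
    opPr μ ℱ (Sᶜ.indicator fun _ => 1) (fun p => 1 - Y p) := by
  have hYm := op_opt_meas hY.1
  refine ⟨measurable_const.sub hY.1, fun T hT A hA => ?_⟩
  have hle : ∀ A, MeasurableSet[sigmaAt ℱ T hT] A → opI μ T A Y ≤ opI μ T A (fun _ => 1) := by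
    intro A hA
    rw [← hY.2 T hT A hA]
    exact op_opI_mono A fun p => Set.indicator_le_self' (fun _ _ => zero_le) p
  have hfin : opI μ T A Y ≠ ∞ := by
    refine ((hle A hA).trans_lt ?_).ne
    rw [op_opI_one]; exact measure_lt_top _ _
  have hae := op_compare hUC hY.1 measurable_const hT hle
  have e1 : opI μ T A Y + opI μ T A (Sᶜ.indicator fun _ => 1) = opI μ T A (fun _ => 1) := by
    rw [← hY.2 T hT A hA, ← op_opI_add hT A (measurable_const.indicator hS)]
    congr 1
    ext p
    by_cases hp : p ∈ S <;> simp [hp]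
  have e2 : opI μ T A Y + opI μ T A (fun p => 1 - Y p) = opI μ T A (fun _ => 1) := by
    rw [← op_opI_add hT A hYm]
    refine setLIntegral_congr_fun_ae ?_ ?_
    · exact (op_sigmaAt_le hT _ hA).inter (op_sigmaAt_le hT _ (op_fin_meas hUC hT))
    · filter_upwards [hae] with ω h1 h2
      exact add_tsub_cancel_of_le (h1 h2.2)
  exact (ENNReal.add_right_inj hfin).1 (e1.trans e2.symm)

lemma op_pr_set [IsProbabilityMeasure μ] (hUC : UsualConditions μ ℱ) {S : Set (ℝ≥0 × Ω)}
    (hS : MeasurableSet S) : ∃ Y, opPr μ ℱ (S.indicator fun _ => 1) Y := by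
  refine MeasurableSpace.induction_on_inter
    (C := fun S _ => ∃ Y, opPr μ ℱ (S.indicator fun _ => 1) Y)
    generateFrom_prod.symm isPiSystem_prod ?_ ?_ ?_ ?_ S hS
  · exact ⟨fun _ => 0, measurable_const, fun T hT A hA => by simp [opI]⟩
  · rintro _ ⟨I, hI, Ξ, hΞ, rfl⟩
    exact op_pr_rect hUC hI hΞ
  · rintro S hS ⟨Y, hY⟩
    exact ⟨_, op_pr_compl hUC hS hY⟩
  · intro f hd hf h
    choose Y hY using h
    refine ⟨fun p => ∑' i, Y i p, Measurable.ennreal_tsum fun i => (hY i).1, fun T hT A hA => ?_⟩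
    have e : ((⋃ i, f i).indicator fun _ => (1 : ℝ≥0∞)) =
        fun p => ∑' i, (f i).indicator (fun _ => 1) p := by
      ext p
      have h1 := measure_iUnion (μ := Measure.dirac p) hd hf
      simp only [Measure.dirac_apply' p (MeasurableSet.iUnion hf),
        Measure.dirac_apply' p (hf _)] at h1
      exact h1
    rw [e]
    unfold opI
    rw [lintegral_tsum, lintegral_tsum]
    · exact tsum_congr fun i => (hY i).2 T hT A hA
    · exact fun i => (op_samp_meas hT (op_opt_meas (hY i).1)).aemeasurable
    · exact fun i => (op_samp_meas hT (measurable_const.indicator (hf i))).aemeasurable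

lemma op_pr_all [IsProbabilityMeasure μ] (hUC : UsualConditions μ ℱ) {X : ℝ≥0 × Ω → ℝ≥0∞}
    (hX : Measurable X) : ∃ Y, opPr μ ℱ X Y := by
  refine Measurable.ennreal_induction (motive := fun X => ∃ Y, opPr μ ℱ X Y) ?_ ?_ ?_ hX
  · intro c S hS
    obtain ⟨Y, hY⟩ := op_pr_set hUC hS
    refine ⟨fun p => c * Y p, measurable_const.mul hY.1, fun T hT A hA => ?_⟩
    have e : (S.indicator fun _ => c) = fun p => c * S.indicator (fun _ => 1) p := by
      ext p; by_cases hp : p ∈ S <;> simp [hp]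
    rw [e]
    unfold opI
    rw [lintegral_const_mul _ (op_samp_meas hT (measurable_const.indicator hS)),
      lintegral_const_mul _ (op_samp_meas hT (op_opt_meas hY.1))]
    exact congrArg _ (hY.2 T hT A hA)
  · rintro f g - hf hg ⟨Y, hY⟩ ⟨Z, hZ⟩
    refine ⟨fun p => Y p + Z p, hY.1.add hZ.1, fun T hT A hA => ?_⟩
    rw [op_opI_add hT A (op_opt_meas hY.1), ← hY.2 T hT A hA, ← hZ.2 T hT A hA,
      ← op_opI_add hT A hf]
    rfl
  · intro f hf hmono h
    choose Y hY using h
    refine ⟨fun p => ⨆ n, Y n p, Measurable.iSup fun n => (hY n).1, fun T hT A hA => ?_⟩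
    have hae : ∀ᵐ ω ∂μ, ∀ n, T ω < ∞ → Y n ((T ω).toNNReal, ω) ≤ Y (n + 1) ((T ω).toNNReal, ω) := by
      refine ae_all_iff.2 fun n => op_compare hUC (hY n).1 (hY (n + 1)).1 hT fun A hA => ?_
      rw [← (hY n).2 T hT A hA, ← (hY (n + 1)).2 T hT A hA]
      exact op_opI_mono A (hmono (Nat.le_succ n))
    have hAm : MeasurableSet (A ∩ {ω | T ω < ∞}) :=
      (op_sigmaAt_le hT _ hA).inter (op_sigmaAt_le hT _ (op_fin_meas hUC hT))
    unfold opI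
    rw [lintegral_iSup (fun n => op_samp_meas hT (hf n)) fun i j hij ω => hmono hij _,
      lintegral_iSup' (fun n => (op_samp_meas hT (op_opt_meas (hY n).1)).aemeasurable)]
    · exact iSup_congr fun n => (hY n).2 T hT A hA
    · rw [ae_restrict_iff' hAm]
      filter_upwards [hae] with ω h1 h2
      exact monotone_nat_of_le_succ fun n => h1 n h2.2

end

section
variable {Ω : Type*} [mΩ : MeasurableSpace Ω] {μ : Measure Ω} {ℱ : Filtration ℝ≥0 mΩ}

lemma op_exists [IsProbabilityMeasure μ] (hUC : UsualConditions μ ℱ) {X : ℝ≥0 → Ω → ℝ}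
    (hX : MeasurableProcess X) : ∃ Y, IsOptProj μ ℱ X Y := by
  have hX' : Measurable fun p : ℝ≥0 × Ω => X p.1 p.2 := hX
  obtain ⟨P, hP⟩ := op_pr_all (μ := μ) (ℱ := ℱ) hUC (ENNReal.measurable_ofReal.comp hX')
  obtain ⟨Q, hQ⟩ := op_pr_all (μ := μ) (ℱ := ℱ) hUC (ENNReal.measurable_ofReal.comp hX'.neg)
  let Y : ℝ≥0 → Ω → ℝ := fun t ω => (P (t, ω)).toReal - (Q (t, ω)).toReal
  have hY : Measurable[optionalSigma ℱ] fun p : ℝ≥0 × Ω => Y p.1 p.2 :=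
    (ENNReal.measurable_toReal.comp hP.1).sub (ENNReal.measurable_toReal.comp hQ.1)
  refine ⟨Y, hY, fun T hT => ⟨stoppedVal Y T, ⟨op_stopped_meas hUC hT hY, ?_⟩, ae_eq_rfl⟩⟩
  intro A hA hint
  have hAm : MeasurableSet (A ∩ {ω | T ω < ∞}) :=
    (op_sigmaAt_le hT _ hA).inter (op_sigmaAt_le hT _ (op_fin_meas hUC hT))
  have e : ∀ Z : ℝ≥0 → Ω → ℝ, A.indicator (stoppedVal Z T) =
      (A ∩ {ω | T ω < ∞}).indicator fun ω => Z (T ω).toNNReal ω := fun Z => by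
    unfold stoppedVal
    rw [Set.indicator_indicator]
  rw [e] at hint
  have hint' : Integrable (fun ω => X (T ω).toNNReal ω) (μ.restrict (A ∩ {ω | T ω < ∞})) :=
    (integrable_indicator_iff hAm).1 hint
  rw [e, e, integral_indicator hAm, integral_indicator hAm,
    integral_eq_lintegral_pos_part_sub_lintegral_neg_part hint']
  have hPf : opI μ T A P ≠ ∞ := by
    rw [← hP.2 T hT A hA]; exact hint'.lintegral_lt_top.ne
  have hQf : opI μ T A Q ≠ ∞ := by
    rw [← hQ.2 T hT A hA]; exact hint'.neg.lintegral_lt_top.ne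
  have hPm := op_samp_meas hT (op_opt_meas hP.1)
  have hQm := op_samp_meas hT (op_opt_meas hQ.1)
  have e1 : (∫⁻ ω in A ∩ {ω | T ω < ∞}, ENNReal.ofReal (X (T ω).toNNReal ω) ∂μ) = opI μ T A P :=
    hP.2 T hT A hA
  have e2 : (∫⁻ ω in A ∩ {ω | T ω < ∞}, ENNReal.ofReal (-X (T ω).toNNReal ω) ∂μ) = opI μ T A Q :=
    hQ.2 T hT A hA
  rw [e1, e2]
  simp only [Y]
  rw [integral_sub (integrable_toReal_of_lintegral_ne_top hPm.aemeasurable hPf)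
    (integrable_toReal_of_lintegral_ne_top hQm.aemeasurable hQf),
    integral_toReal hPm.aemeasurable (ae_lt_top hPm hPf),
    integral_toReal hQm.aemeasurable (ae_lt_top hQm hQf)]
  rfl

end

/-- Existence and uniqueness (up to indistinguishability) of the optional projection. -/
theorem exists_unique_optionalProjection
    {Ω : Type*} [mΩ : MeasurableSpace Ω] (μ : Measure Ω) [IsProbabilityMeasure μ]
    (ℱ : Filtration ℝ≥0 mΩ) (hUC : UsualConditions μ ℱ)
    (X : ℝ≥0 → Ω → ℝ) (hX : MemLop μ ℱ X) :
    ∃ Y : ℝ≥0 → Ω → ℝ, IsOptProj μ ℱ X Y ∧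
      ∀ Y' : ℝ≥0 → Ω → ℝ, IsOptProj μ ℱ X Y' → Indist μ Y' Y := by
  obtain ⟨Y, hY⟩ := op_exists hUC hX.1
  exact ⟨Y, hY, fun Y' hY' => op_unique hUC hX hY hY'⟩

end
end

section
/- Let (Ω, F, (F_t)_{t≥0}, P) be a filtered probability space satisfying the usual conditions. The optional projection operator T : X ↦ ^oX maps L_op into itself (i.e., for X ∈ L_op, (^oX)_S·1_{[S<∞]} is σ-integrable with respect to F_S for every stopping time S) and is a Markov projection on L_op: it is a positive linear operator, ^o(^oX) = ^oX up to indistinguishability for every X ∈ L_op, and ^o1 = 1 where 1 is the constant process. -/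
open MeasureTheory Filter
open scoped ENNReal NNReal

noncomputable section

lemma cyl_aux (K V : Set (ℕ → ℕ)) (hK : IsCompact K) (hV : IsOpen V) (hKV : K ⊆ V) :
    ∃ k : ℕ, ∀ x ∈ K, ∀ y : ℕ → ℕ, (∀ i < k, y i = x i) → y ∈ V := by
  have key : ∃ k : ℕ, ∀ x ∈ K, x ∈ V → ∀ y : ℕ → ℕ, (∀ i < k, y i = x i) → y ∈ V := by
    refine hK.induction_on (p := fun s => ∃ k : ℕ, ∀ x ∈ s, x ∈ V →
      ∀ y : ℕ → ℕ, (∀ i < k, y i = x i) → y ∈ V) ?_ ?_ ?_ ?_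
    · exact ⟨0, by simp⟩
    · rintro s t hst ⟨k, hk⟩
      exact ⟨k, fun x hx => hk x (hst hx)⟩
    · rintro s t ⟨k, hk⟩ ⟨l, hl⟩
      refine ⟨max k l, ?_⟩
      rintro x (hx | hx) hxV y hy
      · exact hk x hx hxV y fun i hi => hy i (lt_of_lt_of_le hi (le_max_left _ _))
      · exact hl x hx hxV y fun i hi => hy i (lt_of_lt_of_le hi (le_max_right _ _))
    · intro x hx
      obtain ⟨v, ⟨z, k, rfl⟩, hxv, hvV⟩ :=
        (PiNat.isTopologicalBasis_cylinders (fun _ : ℕ => ℕ)).exists_subset_of_mem_open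
          (hKV hx) hV
      refine ⟨PiNat.cylinder z k, mem_nhdsWithin_of_mem_nhds
        ((PiNat.isOpen_cylinder _ z k).mem_nhds hxv), k, ?_⟩
      intro x' hx' _ y hy
      apply hvV
      intro i hi
      rw [hy i hi]; exact hx' i hi
  obtain ⟨k, hk⟩ := key
  exact ⟨k, fun x hx => hk x hx (hKV hx)⟩

lemma cap_aux (ν : Measure (ℕ → Bool)) [IsFiniteMeasure ν] (S : Set (ℝ≥0 × (ℕ → Bool)))
    (hS : MeasurableSet S) (c : ℝ≥0∞) (hc : c < ν (Prod.snd '' S)) :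
    ∃ K ⊆ S, IsCompact K ∧ c ≤ ν (Prod.snd '' K) := by
  have : PolishSpace (ℕ → Bool) := by
    let _ := TopologicalSpace.metrizableSpaceMetric (ℕ → Bool)
    infer_instance
  have hA := hS.analyticSet
  rw [AnalyticSet] at hA
  rcases hA with rfl | ⟨f, hf, rfl⟩
  · simp at hc
  set g : (ℕ → ℕ) → (ℕ → Bool) := fun x => (f x).2 with hg
  have hgc : Continuous g := continuous_snd.comp hf
  have step : ∀ (k : ℕ) (Q : Set (ℕ → ℕ)), c < ν (g '' Q) →
      ∃ j : ℕ, c < ν (g '' (Q ∩ {x | x k ≤ j})) := by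
    intro k Q hQ
    have hU : g '' Q = ⋃ j : ℕ, g '' (Q ∩ {x | x k ≤ j}) := by
      rw [← Set.image_iUnion, ← Set.inter_iUnion]
      congr 1
      ext x
      simp only [Set.mem_inter_iff, Set.mem_iUnion, Set.mem_ofPred_eq]
      exact ⟨fun h => ⟨h, x k, le_rfl⟩, fun h => h.1⟩
    have hm : Monotone fun j : ℕ => g '' (Q ∩ {x | x k ≤ j}) := by
      intro i j hij
      apply Set.image_mono
      rintro x ⟨h1, h2⟩
      exact ⟨h1, le_trans h2 hij⟩
    rw [hU, hm.measure_iUnion] at hQ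
    exact lt_iSup_iff.mp hQ
  choose! j hj using step
  let Q : ℕ → Set (ℕ → ℕ) := fun k => Nat.rec Set.univ (fun k Q => Q ∩ {x | x k ≤ j k Q}) k
  have hQs : ∀ k, Q (k+1) = Q k ∩ {x | x k ≤ j k (Q k)} := fun k => rfl
  have hQ : ∀ k, c < ν (g '' Q k) := by
    intro k
    induction k with
    | zero =>
      have : g '' Q 0 = Prod.snd '' Set.range f := by
        change g '' Set.univ = _
        rw [Set.image_univ, ← Set.range_comp]; rfl
      rw [this]; exact hc
    | succ k ih => rw [hQs]; exact hj k _ ih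
  have hQm : ∀ k, ∀ y ∈ Q k, ∀ i < k, y i ≤ j i (Q i) := by
    intro k
    induction k with
    | zero => intro y _ i hi; omega
    | succ k ih =>
      intro y hy i hi
      rw [hQs] at hy
      rcases Nat.lt_succ_iff_lt_or_eq.mp hi with h | h
      · exact ih y hy.1 i h
      · subst h; exact hy.2
  let K0 : Set (ℕ → ℕ) := Set.univ.pi fun i => Set.Iic (j i (Q i))
  have hK0 : IsCompact K0 := isCompact_univ_pi fun i => (Set.finite_Iic _).isCompact
  refine ⟨f '' K0, Set.image_subset_range _ _, hK0.image hf, ?_⟩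
  have him : Prod.snd '' (f '' K0) = g '' K0 := by rw [Set.image_image]
  rw [him, Set.measure_eq_iInf_isOpen]
  refine le_iInf fun U => le_iInf fun hKU => le_iInf fun hU => ?_
  obtain ⟨k, hk⟩ := cyl_aux K0 (g ⁻¹' U) hK0 (hU.preimage hgc) (Set.image_subset_iff.mp hKU)
  refine (hQ k).le.trans (measure_mono ?_)
  rintro _ ⟨y, hy, rfl⟩
  refine hk (fun i => if i < k then y i else 0) ?_ y ?_
  · intro i _
    by_cases h : i < k
    · simpa [h] using hQm k y hy i h
    · simp [h]
  · intro i hi; simp [hi]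

lemma compact_section (K : Set (ℝ≥0 × (ℕ → Bool))) (hK : IsCompact K) :
    ∃ r : (ℕ → Bool) → ℝ≥0, Measurable r ∧ ∀ y ∈ Prod.snd '' K, (r y, y) ∈ K := by
  have hsec : ∀ y, IsCompact {t : ℝ≥0 | (t, y) ∈ K} := by
    intro y
    have : {t : ℝ≥0 | (t, y) ∈ K} = Prod.fst '' (K ∩ Prod.snd ⁻¹' {y}) := by
      ext t
      constructor
      · intro h; exact ⟨(t, y), ⟨h, rfl⟩, rfl⟩
      · rintro ⟨⟨a, b⟩, ⟨h1, h2⟩, rfl⟩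
        simp only [Set.mem_preimage, Set.mem_singleton_iff] at h2
        subst h2; exact h1
    rw [this]
    exact (hK.inter_right (isClosed_singleton.preimage continuous_snd)).image continuous_fst
  have hmem : ∀ y ∈ Prod.snd '' K, (sInf {t : ℝ≥0 | (t, y) ∈ K}, y) ∈ K := by
    rintro y ⟨⟨a, b⟩, h, rfl⟩
    exact (hsec b).sInf_mem ⟨a, h⟩
  refine ⟨fun y => sInf {t : ℝ≥0 | (t, y) ∈ K}, ?_, hmem⟩
  refine measurable_of_Iic fun a => ?_
  have : (fun y => sInf {t : ℝ≥0 | (t, y) ∈ K}) ⁻¹' Set.Iic a =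
      (Prod.snd '' K)ᶜ ∪ Prod.snd '' (K ∩ Prod.fst ⁻¹' Set.Iic a) := by
    ext y
    by_cases hy : y ∈ Prod.snd '' K
    · constructor
      · intro h; right; exact ⟨_, ⟨hmem y hy, h⟩, rfl⟩
      · rintro (h | ⟨⟨b, z⟩, ⟨h1, h2⟩, rfl⟩)
        · exact absurd hy h
        · have h1' : b ∈ {t : ℝ≥0 | (t, z) ∈ K} := h1
          exact (csInf_le (OrderBot.bddBelow _) h1').trans h2
    · have he : {t : ℝ≥0 | (t, y) ∈ K} = ∅ := by
        ext t; simp only [Set.mem_ofPred_eq, Set.mem_empty_iff_false, iff_false]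
        intro h; exact hy ⟨_, h, rfl⟩
      constructor
      · intro _; left; exact hy
      · intro _; simp [he]
  rw [this]
  refine MeasurableSet.union ?_ ?_
  · exact (hK.image continuous_snd).measurableSet.compl
  · exact ((hK.inter_right (isClosed_Iic.preimage continuous_fst)).image
      continuous_snd).measurableSet

lemma reduce_cantor {Ω : Type*} [m : MeasurableSpace Ω] (A : Set (ℝ≥0 × Ω))
    (hA : MeasurableSet A) : ∃ φ : Ω → (ℕ → Bool), Measurable φ ∧
      ∃ A' : Set (ℝ≥0 × (ℕ → Bool)), MeasurableSet A' ∧ A = {p | (p.1, φ p.2) ∈ A'} := by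
  classical
  rw [← generateFrom_prod] at hA
  induction A, hA using MeasurableSpace.generateFrom_induction with
  | hC s hs _ =>
    obtain ⟨S, hS, F, hF, rfl⟩ := hs
    refine ⟨fun ω _ => decide (ω ∈ F), ?_, S ×ˢ {x | x 0 = true}, ?_, ?_⟩
    · refine measurable_pi_lambda _ fun _ => ?_
      refine measurable_to_bool ?_
      have : (fun ω => decide (ω ∈ F)) ⁻¹' {true} = F := by ext; simp
      rw [this]; exact hF
    · refine MeasurableSet.prod hS ?_
      have h0 : Measurable fun x : ℕ → Bool => x 0 := measurable_pi_apply 0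
      exact h0 (measurableSet_singleton true)
    · ext p; simp
  | empty => exact ⟨fun _ _ => true, measurable_const, ∅, MeasurableSet.empty, by simp⟩
  | compl t _ ih =>
    obtain ⟨φ, hφ, A', hA', rfl⟩ := ih
    exact ⟨φ, hφ, A'ᶜ, hA'.compl, rfl⟩
  | iUnion s _ ih =>
    choose φ hφ A' hA' h using ih
    refine ⟨fun ω k => φ k.unpair.1 ω k.unpair.2, ?_,
      ⋃ n, {p | (p.1, fun j => p.2 (Nat.pair n j)) ∈ A' n}, ?_, ?_⟩
    · refine measurable_pi_lambda _ fun k => ?_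
      exact (measurable_pi_apply _).comp (hφ _)
    · refine MeasurableSet.iUnion fun n => ?_
      have : Measurable fun p : ℝ≥0 × (ℕ → Bool) => (p.1, fun j => p.2 (Nat.pair n j)) := by
        fun_prop
      exact this (hA' n)
    · ext p
      simp only [Set.mem_iUnion]
      refine exists_congr fun n => ?_
      rw [h n]
      simp

lemma section_gen {Ω : Type*} [m : MeasurableSpace Ω] (μ : Measure Ω) [IsFiniteMeasure μ]
    (A : Set (ℝ≥0 × Ω)) (hA : MeasurableSet A) (c : ℝ≥0∞) (hc : c < μ (Prod.snd '' A)) :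
    ∃ (E : Set Ω) (R : Ω → ℝ≥0), MeasurableSet E ∧ Measurable R ∧
      (∀ ω ∈ E, (R ω, ω) ∈ A) ∧ c ≤ μ E := by
  obtain ⟨φ, hφ, A', hA', rfl⟩ := reduce_cantor A hA
  have h1 : μ (Prod.snd '' {p : ℝ≥0 × Ω | (p.1, φ p.2) ∈ A'}) ≤
      (μ.map φ) (Prod.snd '' A') := by
    refine le_trans (measure_mono ?_) (Measure.le_map_apply hφ.aemeasurable _)
    rintro _ ⟨⟨a, b⟩, h, rfl⟩
    exact ⟨_, h, rfl⟩
  obtain ⟨K, hKA, hK, hcK⟩ := cap_aux (μ.map φ) A' hA' c (hc.trans_le h1)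
  obtain ⟨r, hr, hrK⟩ := compact_section K hK
  have hm : MeasurableSet (Prod.snd '' K) := (hK.image continuous_snd).measurableSet
  refine ⟨φ ⁻¹' (Prod.snd '' K), r ∘ φ, hφ hm, hr.comp hφ, fun ω hω => hKA (hrK _ hω), ?_⟩
  rwa [Measure.map_apply hφ hm] at hcK

lemma proj_null {Ω : Type*} [m : MeasurableSpace Ω] (μ : Measure Ω) [IsFiniteMeasure μ]
    (A : Set (ℝ≥0 × Ω)) (hA : MeasurableSet A) :
    ∃ E N : Set Ω, MeasurableSet E ∧ MeasurableSet N ∧ E ⊆ Prod.snd '' A ∧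
      Prod.snd '' A ⊆ E ∪ N ∧ μ N = 0 := by
  by_cases h0 : μ (Prod.snd '' A) = 0
  · refine ⟨∅, toMeasurable μ (Prod.snd '' A), MeasurableSet.empty, measurableSet_toMeasurable _ _,
      Set.empty_subset _, ?_, by rwa [measure_toMeasurable]⟩
    rw [Set.empty_union]; exact subset_toMeasurable _ _
  obtain ⟨u, -, hu, hut⟩ := exists_seq_strictMono_tendsto' (pos_iff_ne_zero.mpr h0)
  choose E R hE _ hER hcE using fun n => section_gen μ A hA (u n) (hu n).2
  have hsub : (⋃ n, E n) ⊆ Prod.snd '' A := by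
    intro ω hω
    obtain ⟨n, hn⟩ := Set.mem_iUnion.mp hω
    exact ⟨_, hER n ω hn, rfl⟩
  have hEm : MeasurableSet (⋃ n, E n) := MeasurableSet.iUnion hE
  refine ⟨⋃ n, E n, toMeasurable μ (Prod.snd '' A) \ ⋃ n, E n, hEm,
    (measurableSet_toMeasurable _ _).diff hEm, hsub, ?_, ?_⟩
  · intro ω hω
    by_cases h : ω ∈ ⋃ n, E n
    · exact Or.inl h
    · exact Or.inr ⟨subset_toMeasurable _ _ hω, h⟩
  · rw [measure_sdiff (hsub.trans (subset_toMeasurable _ _)) hEm.nullMeasurableSet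
      (measure_ne_top _ _), measure_toMeasurable]
    rw [tsub_eq_zero_iff_le]
    exact le_of_tendsto' hut fun n => (hcE n).trans (measure_mono (Set.subset_iUnion E n))

lemma sigmaAt_le {Ω : Type*} [mΩ : MeasurableSpace Ω] (ℱ : Filtration ℝ≥0 mΩ) (T : Ω → ℝ≥0∞)
    (hT : IsStopTime ℱ T) : sigmaAt ℱ T hT ≤ mΩ := by
  intro A hA
  exact (iSup_le fun t => ℱ.le t : (⨆ t : ℝ≥0, (ℱ t : MeasurableSpace Ω)) ≤ mΩ) A hA.1

lemma gce_condExp {Ω : Type*} {mΩ : MeasurableSpace Ω} (μ : Measure Ω) [IsProbabilityMeasure μ]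
    (G : MeasurableSpace Ω) (hG : G ≤ mΩ) (ξ η : Ω → ℝ) (h : IsGCE μ G ξ η) (B : Set Ω)
    (hB : MeasurableSet[G] B) (hint : Integrable (B.indicator ξ) μ) :
    B.indicator η =ᵐ[μ] μ[B.indicator ξ | G] := by
  obtain ⟨hη, hI⟩ := h
  have hC : ∀ n : ℕ, MeasurableSet[G] {ω | |η ω| ≤ n} := fun n =>
    (measurable_abs.comp hη) measurableSet_Iic
  have key : ∀ n : ℕ, ∀ᵐ ω ∂μ, ω ∈ {ω | |η ω| ≤ (n : ℝ)} →
      B.indicator η ω = (μ[B.indicator ξ | G]) ω := by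
    intro n
    set C := {ω | |η ω| ≤ (n : ℝ)} with hCdef
    have hbd : Integrable (C.indicator (B.indicator η)) μ := by
      refine Integrable.of_bound (C := n)
        (((hη.indicator hB).indicator (hC n)).mono hG le_rfl).aestronglyMeasurable ?_
      refine Eventually.of_forall fun ω => ?_
      by_cases h1 : ω ∈ C
      · by_cases h2 : ω ∈ B
        · rw [Set.indicator_of_mem h1, Set.indicator_of_mem h2]; exact h1
        · simp [h1, h2]
      · simp [h1]
    have e1 : C.indicator (B.indicator η) =ᵐ[μ] μ[C.indicator (B.indicator ξ) | G] := by
      refine ae_eq_condExp_of_forall_setIntegral_eq hG (hint.indicator (hG _ (hC n)))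
        (fun s _ _ => hbd.integrableOn) ?_
        ((hη.indicator hB).indicator (hC n)).stronglyMeasurable.aestronglyMeasurable
      intro s hs _
      rw [← integral_indicator (hG _ hs), ← integral_indicator (hG _ hs)]
      simp only [Set.indicator_indicator]
      refine (hI _ (hs.inter ((hC n).inter hB)) ?_).symm
      have := (hint.indicator (hG _ (hC n))).indicator (hG _ hs)
      simpa only [Set.indicator_indicator] using this
    have e2 := condExp_indicator (μ := μ) hint (hC n)
    filter_upwards [e1, e2] with ω h1 h2 hω
    rw [h2] at h1
    rwa [Set.indicator_of_mem hω, Set.indicator_of_mem hω] at h1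
  filter_upwards [ae_all_iff.mpr key] with ω hω
  obtain ⟨n, hn⟩ := exists_nat_ge (|η ω|)
  exact hω n hn

lemma gce_of_condExp {Ω : Type*} {mΩ : MeasurableSpace Ω} (μ : Measure Ω)
    [IsProbabilityMeasure μ]
    (G : MeasurableSpace Ω) (hG : G ≤ mΩ) (ξ η : Ω → ℝ) (hη : Measurable[G] η)
    (s : ℕ → Set Ω) (hs : ∀ n, MeasurableSet[G] (s n)) (hU : (⋃ n, s n) = Set.univ)
    (hint : ∀ n, Integrable ((s n).indicator ξ) μ)
    (h : ∀ n, (s n).indicator η =ᵐ[μ] μ[(s n).indicator ξ | G]) : IsGCE μ G ξ η := by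
  refine ⟨hη, fun A hA hAi => ?_⟩
  have key : A.indicator η =ᵐ[μ] μ[A.indicator ξ | G] := by
    have e1 := fun n => condExp_indicator (μ := μ) (hint n) hA
    have e2 := fun n => condExp_indicator (μ := μ) hAi (hs n)
    filter_upwards [ae_all_iff.mpr e1, ae_all_iff.mpr e2, ae_all_iff.mpr h] with ω h1 h2 h3
    obtain ⟨n, hn⟩ := Set.mem_iUnion.mp (hU ▸ Set.mem_univ ω : ω ∈ ⋃ n, s n)
    have h1 := h1 n
    have h2 := h2 n
    have h3 := h3 n
    rw [Set.indicator_indicator] at h1 h2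
    rw [Set.inter_comm, h1, Set.indicator_of_mem hn] at h2
    rw [← h2]
    rw [Set.indicator_of_mem hn] at h3
    by_cases hωA : ω ∈ A
    · simp [hωA, h3]
    · simp [hωA]
  rw [integral_congr_ae key, integral_condExp hG]

lemma sigmaInt_of_meas {Ω : Type*} {mΩ : MeasurableSpace Ω} (μ : Measure Ω)
    [IsProbabilityMeasure μ]
    (G : MeasurableSpace Ω) (hG : G ≤ mΩ) (ξ η : Ω → ℝ) (hη : Measurable[G] η)
    (h : η =ᵐ[μ] ξ) : SigmaIntegrable μ G ξ := by
  refine ⟨fun n => {ω | |η ω| ≤ (n : ℝ)}, fun n => (measurable_abs.comp hη) measurableSet_Iic,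
    ?_, ?_, ?_⟩
  · intro i j hij ω hω
    exact le_trans (show |η ω| ≤ (i : ℝ) from hω) (by exact_mod_cast hij)
  · ext ω
    simp only [Set.mem_iUnion, Set.mem_univ, iff_true]
    obtain ⟨n, hn⟩ := exists_nat_ge (|η ω|)
    exact ⟨n, hn⟩
  · intro n
    have hm : MeasurableSet[G] {ω | |η ω| ≤ (n : ℝ)} := (measurable_abs.comp hη) measurableSet_Iic
    have h1 : Integrable ({ω | |η ω| ≤ (n : ℝ)}.indicator η) μ := by
      refine Integrable.of_bound (C := n)
        ((hη.indicator hm).mono hG le_rfl).aestronglyMeasurable ?_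
      refine Eventually.of_forall fun ω => ?_
      by_cases h1 : ω ∈ {ω | |η ω| ≤ (n : ℝ)}
      · rw [Set.indicator_of_mem h1]; exact h1
      · rw [Set.indicator_of_notMem h1]; simp
    refine h1.congr ?_
    filter_upwards [h] with ω hω
    simp only [Set.indicator, hω]

lemma gce_idem {Ω : Type*} {mΩ : MeasurableSpace Ω} (μ : Measure Ω) [IsProbabilityMeasure μ]
    (G : MeasurableSpace Ω) (hG : G ≤ mΩ) (ξ η η0 : Ω → ℝ) (h : IsGCE μ G ξ η)
    (hη0 : Measurable[G] η0) (h0 : η0 =ᵐ[μ] ξ) : η =ᵐ[μ] ξ := by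
  obtain ⟨s, hs, -, hU, hint⟩ := sigmaInt_of_meas μ G hG ξ η0 hη0 h0
  have key : ∀ n, (s n).indicator η =ᵐ[μ] (s n).indicator ξ := by
    intro n
    have e1 := gce_condExp μ G hG ξ η h (s n) (hs n) (hint n)
    have e3 : (s n).indicator η0 =ᵐ[μ] (s n).indicator ξ := by
      filter_upwards [h0] with ω hω
      simp only [Set.indicator, hω]
    have e2 : μ[(s n).indicator ξ | G] =ᵐ[μ] μ[(s n).indicator η0 | G] :=
      condExp_congr_ae e3.symm
    rw [condExp_of_stronglyMeasurable hG (hη0.indicator (hs n)).stronglyMeasurable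
      ((hint n).congr e3.symm)] at e2
    exact e1.trans (e2.trans e3)
  filter_upwards [ae_all_iff.mpr key] with ω hω
  obtain ⟨n, hn⟩ := Set.mem_iUnion.mp (hU ▸ Set.mem_univ ω : ω ∈ ⋃ n, s n)
  have := hω n
  rwa [Set.indicator_of_mem hn, Set.indicator_of_mem hn] at this

lemma gce_nonneg {Ω : Type*} {mΩ : MeasurableSpace Ω} (μ : Measure Ω) [IsProbabilityMeasure μ]
    (G : MeasurableSpace Ω) (hG : G ≤ mΩ) (ξ η : Ω → ℝ) (h : IsGCE μ G ξ η)
    (hS : SigmaIntegrable μ G ξ) (h0 : ∀ᵐ ω ∂μ, 0 ≤ ξ ω) : ∀ᵐ ω ∂μ, 0 ≤ η ω := by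
  obtain ⟨s, hs, -, hU, hint⟩ := hS
  have key : ∀ n, ∀ᵐ ω ∂μ, 0 ≤ (s n).indicator η ω := by
    intro n
    have e1 := gce_condExp μ G hG ξ η h (s n) (hs n) (hint n)
    have e2 : 0 ≤ᵐ[μ] μ[(s n).indicator ξ | G] := by
      refine condExp_nonneg ?_
      filter_upwards [h0] with ω hω
      exact Set.indicator_apply_nonneg fun _ => hω
    filter_upwards [e1, e2] with ω h1 h2
    rw [h1]; exact h2
  filter_upwards [ae_all_iff.mpr key] with ω hω
  obtain ⟨n, hn⟩ := Set.mem_iUnion.mp (hU ▸ Set.mem_univ ω : ω ∈ ⋃ n, s n)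
  have := hω n
  rwa [Set.indicator_of_mem hn] at this

lemma gce_add {Ω : Type*} {mΩ : MeasurableSpace Ω} (μ : Measure Ω) [IsProbabilityMeasure μ]
    (G : MeasurableSpace Ω) (hG : G ≤ mΩ) (ξ η ξ' η' : Ω → ℝ) (h : IsGCE μ G ξ η)
    (h' : IsGCE μ G ξ' η') (hS : SigmaIntegrable μ G ξ) (hS' : SigmaIntegrable μ G ξ') :
    IsGCE μ G (ξ + ξ') (η + η') := by
  obtain ⟨s, hs, hsm, hU, hint⟩ := hS
  obtain ⟨s', hs', hsm', hU', hint'⟩ := hS'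
  have i1 : ∀ n, Integrable ((s n ∩ s' n).indicator ξ) μ := by
    intro n
    rw [Set.inter_comm, ← Set.indicator_indicator]
    exact (hint n).indicator (hG _ (hs' n))
  have i2 : ∀ n, Integrable ((s n ∩ s' n).indicator ξ') μ := by
    intro n
    rw [← Set.indicator_indicator]
    exact (hint' n).indicator (hG _ (hs n))
  refine gce_of_condExp μ G hG _ _ (h.1.add h'.1) (fun n => s n ∩ s' n)
    (fun n => (hs n).inter (hs' n)) ?_ ?_ ?_
  · rw [Set.iUnion_inter_of_monotone hsm hsm', hU, hU', Set.univ_inter]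
  · intro n
    rw [Set.indicator_add']
    exact (i1 n).add (i2 n)
  · intro n
    rw [Set.indicator_add', Set.indicator_add']
    have e1 := gce_condExp μ G hG ξ η h _ ((hs n).inter (hs' n)) (i1 n)
    have e2 := gce_condExp μ G hG ξ' η' h' _ ((hs n).inter (hs' n)) (i2 n)
    exact (e1.add e2).trans (condExp_add (i1 n) (i2 n) G).symm

lemma gce_smul {Ω : Type*} {mΩ : MeasurableSpace Ω} (μ : Measure Ω) [IsProbabilityMeasure μ]
    (G : MeasurableSpace Ω) (hG : G ≤ mΩ) (c : ℝ) (ξ η : Ω → ℝ) (h : IsGCE μ G ξ η)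
    (hS : SigmaIntegrable μ G ξ) :
    IsGCE μ G (c • ξ) (c • η) := by
  obtain ⟨s, hs, hsm, hU, hint⟩ := hS
  refine gce_of_condExp μ G hG _ _ (h.1.const_smul c) s hs hU ?_ ?_
  · intro n
    have e : (s n).indicator (c • ξ) = c • (s n).indicator ξ := Set.indicator_const_smul _ c ξ
    rw [e]
    exact (hint n).smul c
  · intro n
    have e1 := gce_condExp μ G hG ξ η h _ (hs n) (hint n)
    have e : (s n).indicator (c • ξ) = c • (s n).indicator ξ := Set.indicator_const_smul _ c ξ
    have e' : (s n).indicator (c • η) = c • (s n).indicator η := Set.indicator_const_smul _ c η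
    rw [e, e']
    exact (e1.const_smul c).trans (condExp_smul c _ G).symm

lemma prog_aux {Ω : Type*} [m : MeasurableSpace Ω] (X : ℝ≥0 → Ω → ℝ) (t : ℝ≥0)
    (hX : ∀ s ≤ t, Measurable (X s))
    (hc : ∀ ω, ∀ t : ℝ≥0, ContinuousWithinAt (fun s => X s ω) (Set.Ici t) t) (C : Set ℝ)
    (hC : MeasurableSet C) :
    MeasurableSet {p : ℝ≥0 × Ω | p.1 < t ∧ X p.1 p.2 ∈ C} := by
  classical
  let D : Set (ℝ≥0 × Ω) := {p | p.1 < t}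
  have hD : MeasurableSet D := measurable_fst measurableSet_Iio
  let d : ℕ → ℕ → ℝ≥0 := fun n k => min (((k : ℝ≥0) + 1) / ((n : ℝ≥0) + 1)) t
  let gn : ℕ → ℝ≥0 × Ω → ℝ := fun n => D.indicator fun p =>
    X (d n ⌊p.1 * ((n : ℝ≥0) + 1)⌋₊) p.2
  let g : ℝ≥0 × Ω → ℝ := D.indicator fun p => X p.1 p.2
  have hgn : ∀ n, Measurable (gn n) := by
    intro n
    refine Measurable.indicator ?_ hD
    have h1 : Measurable fun q : ℕ × Ω => X (d n q.1) q.2 :=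
      measurable_from_prod_countable_right fun k => hX (d n k) (min_le_right _ _)
    have h2 : Measurable fun p : ℝ≥0 × Ω => ((⌊p.1 * ((n : ℝ≥0) + 1)⌋₊, p.2) : ℕ × Ω) := by
      refine Measurable.prodMk ?_ measurable_snd
      exact Nat.measurable_floor.comp (measurable_fst.mul_const _)
    have h3 := h1.comp h2
    simpa only [Function.comp_def] using h3
  have hg : Measurable g := by
    refine measurable_of_tendsto_metrizable hgn ?_
    rw [tendsto_pi_nhds]
    rintro ⟨s, ω⟩
    by_cases hs : s < t
    · have hsD : (s, ω) ∈ D := hs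
      simp only [gn, g, Set.indicator_of_mem hsD]
      have hlow : ∀ n : ℕ, s ≤ ((⌊s * ((n : ℝ≥0) + 1)⌋₊ : ℝ≥0) + 1) / ((n : ℝ≥0) + 1) := by
        intro n
        rw [le_div_iff₀ (by positivity)]
        exact (Nat.lt_floor_add_one _).le
      have hup : ∀ n : ℕ, ((⌊s * ((n : ℝ≥0) + 1)⌋₊ : ℝ≥0) + 1) / ((n : ℝ≥0) + 1) ≤
          s + 1 / ((n : ℝ≥0) + 1) := by
        intro n
        rw [div_le_iff₀ (by positivity), add_mul, one_div, inv_mul_cancel₀ (by positivity)]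
        gcongr
        exact Nat.floor_le zero_le
      have hlim : Tendsto (fun n : ℕ => d n ⌊s * ((n : ℝ≥0) + 1)⌋₊) atTop (nhds s) := by
        have h1 : Tendsto (fun n : ℕ => s + 1 / ((n : ℝ≥0) + 1)) atTop (nhds s) := by
          have := (tendsto_one_div_add_atTop_nhds_zero_nat (𝕜 := ℝ≥0)).const_add s
          simpa using this
        refine tendsto_of_tendsto_of_tendsto_of_le_of_le tendsto_const_nhds h1 ?_ ?_
        · intro n; exact le_min (hlow n) hs.le
        · intro n; exact (min_le_left _ _).trans (hup n)
      exact (hc ω s).tendsto.comp (tendsto_nhdsWithin_iff.mpr ⟨hlim,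
        Eventually.of_forall fun n => le_min (hlow n) hs.le⟩)
    · have hsD : (s, ω) ∉ D := hs
      simp only [gn, g, Set.indicator_of_notMem hsD]
      exact tendsto_const_nhds
  have : {p : ℝ≥0 × Ω | p.1 < t ∧ X p.1 p.2 ∈ C} = D ∩ g ⁻¹' C := by
    ext p
    constructor
    · rintro ⟨h1, h2⟩
      have hp : p ∈ D := h1
      refine ⟨h1, ?_⟩
      simp only [Set.mem_preimage, g, Set.indicator_of_mem hp]; exact h2
    · rintro ⟨h1, h2⟩
      refine ⟨h1, ?_⟩
      simpa only [Set.mem_preimage, g, Set.indicator_of_mem h1] using h2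
  rw [this]
  exact hD.inter (hg hC)

/-- sets whose trace on a measurable set is measurable -/
def traceSigma {α : Type*} (m : MeasurableSpace α) (D : Set α) (hD : MeasurableSet[m] D) :
    MeasurableSpace α where
  MeasurableSet' A := MeasurableSet[m] (D ∩ A)
  measurableSet_empty := by simp
  measurableSet_compl A hA := by
    have : D ∩ Aᶜ = D \ (D ∩ A) := by ext; simp
    rw [this]; exact hD.diff hA
  measurableSet_iUnion f hf := by
    rw [Set.inter_iUnion]; exact MeasurableSet.iUnion hf

lemma opt_prog {Ω : Type*} [mΩ : MeasurableSpace Ω] (ℱ : Filtration ℝ≥0 mΩ)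
    (A : Set (ℝ≥0 × Ω)) (hA : MeasurableSet[optionalSigma ℱ] A) (t : ℝ≥0) :
    MeasurableSet[@Prod.instMeasurableSpace _ _ _ (ℱ t)] ({p : ℝ≥0 × Ω | p.1 < t} ∩ A) := by
  have hD : MeasurableSet[@Prod.instMeasurableSpace _ _ _ (ℱ t)] {p : ℝ≥0 × Ω | p.1 < t} :=
    (@measurable_fst _ _ _ (ℱ t)) measurableSet_Iio
  have hle : optionalSigma ℱ ≤ traceSigma (@Prod.instMeasurableSpace _ _ _ (ℱ t)) _ hD := by
    refine iSup₂_le fun X hX => ?_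
    rintro _ ⟨C, hC, rfl⟩
    refine @prog_aux Ω (ℱ t) X t (fun s hs => (hX.2.2 s).mono (ℱ.mono hs) le_rfl) hX.1 C ?_
    rwa [BorelSpace.measurable_eq (α := ℝ)]
  exact hle A hA

lemma opt_le {Ω : Type*} [mΩ : MeasurableSpace Ω] (ℱ : Filtration ℝ≥0 mΩ) :
    optionalSigma ℱ ≤ (Prod.instMeasurableSpace : MeasurableSpace (ℝ≥0 × Ω)) := by
  intro A hA
  have h : A = ⋃ n : ℕ, {p : ℝ≥0 × Ω | p.1 < n} ∩ A := by
    rw [← Set.iUnion_inter]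
    ext p
    simp only [Set.mem_inter_iff, Set.mem_iUnion]
    exact ⟨fun h => ⟨exists_nat_gt p.1, h⟩, fun h => h.2⟩
  rw [h]
  refine MeasurableSet.iUnion fun n => ?_
  have hle : (@Prod.instMeasurableSpace ℝ≥0 Ω _ (ℱ n)) ≤
      (Prod.instMeasurableSpace : MeasurableSpace (ℝ≥0 × Ω)) :=
    sup_le_sup le_rfl (MeasurableSpace.comap_mono (ℱ.le _))
  exact hle _ (opt_prog ℱ A hA n)

/-- sections closed under limits from the right -/
def RClosed {Ω : Type*} (B : Set (ℝ≥0 × Ω)) : Prop :=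
  ∀ ω t, (t, ω) ∉ B → ∀ᶠ s in nhdsWithin t (Set.Ici t), (s, ω) ∉ B

/-- inner approximable sets -/
def InnerApp {Ω : Type*} [mΩ : MeasurableSpace Ω] (ℱ : Filtration ℝ≥0 mΩ)
    (ν : Measure (ℝ≥0 × Ω)) (A : Set (ℝ≥0 × Ω)) : Prop :=
  ∀ ε : ℝ≥0∞, ε ≠ 0 → ∃ B ⊆ A, MeasurableSet[optionalSigma ℱ] B ∧ RClosed B ∧ ν (A \ B) ≤ ε

lemma inner_iInter {Ω : Type*} [mΩ : MeasurableSpace Ω] (ℱ : Filtration ℝ≥0 mΩ)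
    (ν : Measure (ℝ≥0 × Ω)) (A : ℕ → Set (ℝ≥0 × Ω)) (h : ∀ n, InnerApp ℱ ν (A n)) :
    InnerApp ℱ ν (⋂ n, A n) := by
  intro ε hε
  obtain ⟨δ, hδ, hsum⟩ := ENNReal.exists_pos_sum_of_countable' hε ℕ
  choose B hBA hBm hBc hBν using fun n => h n (δ n) (hδ n).ne'
  refine ⟨⋂ n, B n, Set.iInter_mono hBA, MeasurableSet.iInter hBm, ?_, ?_⟩
  · intro ω t ht
    simp only [Set.mem_iInter, not_forall] at ht
    obtain ⟨n, hn⟩ := ht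
    filter_upwards [hBc n ω t hn] with s hs h
    exact hs (Set.mem_iInter.mp h n)
  · calc ν ((⋂ n, A n) \ ⋂ n, B n) ≤ ν (⋃ n, A n \ B n) := by
          refine measure_mono ?_
          rintro p ⟨h1, h2⟩
          simp only [Set.mem_iInter, not_forall] at h1 h2
          obtain ⟨n, hn⟩ := h2
          exact Set.mem_iUnion.mpr ⟨n, h1 n, hn⟩
      _ ≤ ∑' n, ν (A n \ B n) := measure_iUnion_le _
      _ ≤ ∑' n, δ n := ENNReal.tsum_le_tsum hBν
      _ ≤ ε := hsum.le

lemma inner_iUnion {Ω : Type*} [mΩ : MeasurableSpace Ω] (ℱ : Filtration ℝ≥0 mΩ)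
    (ν : Measure (ℝ≥0 × Ω)) [IsFiniteMeasure ν] (A : ℕ → Set (ℝ≥0 × Ω))
    (h : ∀ n, InnerApp ℱ ν (A n)) :
    InnerApp ℱ ν (⋃ n, A n) := by
  intro ε hε
  have hε2 : ε / 2 ≠ 0 := (ENNReal.half_pos hε).ne'
  obtain ⟨δ, hδ, hsum⟩ := ENNReal.exists_pos_sum_of_countable' hε2 ℕ
  choose B hBA hBm hBc hBν using fun n => h n (δ n) (hδ n).ne'
  let P : ℕ → Set (ℝ≥0 × Ω) := fun n => Nat.rec (B 0) (fun k S => S ∪ B (k+1)) n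
  have hPs : ∀ n, P (n+1) = P n ∪ B (n+1) := fun n => rfl
  have hPm : ∀ n, MeasurableSet[optionalSigma ℱ] (P n) := by
    intro n
    induction n with
    | zero => exact hBm 0
    | succ n ih => rw [hPs]; exact ih.union (hBm _)
  have hPc : ∀ n, RClosed (P n) := by
    intro n
    induction n with
    | zero => exact hBc 0
    | succ n ih =>
      rw [hPs]
      intro ω t ht
      rw [Set.mem_union, not_or] at ht
      filter_upwards [ih ω t ht.1, hBc (n+1) ω t ht.2] with s h1 h2
      rw [Set.mem_union, not_or]; exact ⟨h1, h2⟩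
  have hPA : ∀ n, P n ⊆ ⋃ n, A n := by
    intro n
    induction n with
    | zero => exact (hBA 0).trans (Set.subset_iUnion A 0)
    | succ n ih => rw [hPs]; exact Set.union_subset ih ((hBA _).trans (Set.subset_iUnion A _))
  have hPmono : Monotone P := monotone_nat_of_le_succ fun n => by
    rw [hPs]; exact Set.subset_union_left
  have hBP : ∀ n, B n ⊆ P n := by
    intro n
    cases n with
    | zero => exact subset_rfl
    | succ n => rw [hPs]; exact Set.subset_union_right
  have hPB : (⋃ n, B n) ⊆ ⋃ n, P n := Set.iUnion_mono hBP
  have hUm : MeasurableSet (⋃ n, P n) := MeasurableSet.iUnion fun n => opt_le ℱ _ (hPm n)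
  have hlim : Tendsto (fun n => ν ((⋃ n, P n) \ P n)) atTop (nhds (ν (⋂ n, (⋃ n, P n) \ P n))) := by
    refine tendsto_measure_iInter_atTop
      (fun n => (hUm.diff (opt_le ℱ _ (hPm n))).nullMeasurableSet) ?_ ⟨0, measure_ne_top _ _⟩
    intro i j hij
    exact Set.sdiff_subset_sdiff_right (hPmono hij)
  have hemp : (⋂ n, (⋃ n, P n) \ P n) = ∅ := by
    ext p
    simp only [Set.mem_iInter, Set.mem_empty_iff_false, iff_false]
    intro hp
    obtain ⟨n, hn⟩ := Set.mem_iUnion.mp (hp 0).1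
    exact (hp n).2 hn
  rw [hemp, measure_empty] at hlim
  obtain ⟨n, hn⟩ := (hlim.eventually (gt_mem_nhds (pos_iff_ne_zero.mpr hε2))).exists
  refine ⟨P n, hPA n, hPm n, hPc n, ?_⟩
  calc ν ((⋃ n, A n) \ P n) ≤ ν ((⋃ n, A n \ B n) ∪ ((⋃ n, P n) \ P n)) := by
        refine measure_mono ?_
        rintro p ⟨h1, h2⟩
        obtain ⟨k, hk⟩ := Set.mem_iUnion.mp h1
        by_cases hb : p ∈ B k
        · exact Or.inr ⟨hPB (Set.mem_iUnion.mpr ⟨k, hb⟩), h2⟩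
        · exact Or.inl (Set.mem_iUnion.mpr ⟨k, hk, hb⟩)
    _ ≤ ν (⋃ n, A n \ B n) + ν ((⋃ n, P n) \ P n) := measure_union_le _ _
    _ ≤ ε / 2 + ε / 2 := by
        refine add_le_add ?_ hn.le
        calc ν (⋃ n, A n \ B n) ≤ ∑' n, ν (A n \ B n) := measure_iUnion_le _
          _ ≤ ∑' n, δ n := ENNReal.tsum_le_tsum hBν
          _ ≤ ε / 2 := hsum.le
    _ = ε := ENNReal.add_halves ε

lemma inner_self {Ω : Type*} [mΩ : MeasurableSpace Ω] (ℱ : Filtration ℝ≥0 mΩ)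
    (ν : Measure (ℝ≥0 × Ω)) (B : Set (ℝ≥0 × Ω)) (hB : MeasurableSet[optionalSigma ℱ] B)
    (hc : RClosed B) : InnerApp ℱ ν B :=
  fun ε _ => ⟨B, subset_rfl, hB, hc, by simp⟩

/-- sets which are inner approximable along with their complement -/
def appSigma {Ω : Type*} [mΩ : MeasurableSpace Ω] (ℱ : Filtration ℝ≥0 mΩ)
    (ν : Measure (ℝ≥0 × Ω)) [IsFiniteMeasure ν] : MeasurableSpace (ℝ≥0 × Ω) where
  MeasurableSet' A := InnerApp ℱ ν A ∧ InnerApp ℱ ν Aᶜ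
  measurableSet_empty :=
    ⟨inner_self ℱ ν _ (@MeasurableSet.empty _ (optionalSigma ℱ)) (by intro _ _ _; simp),
      inner_self ℱ ν _ (@MeasurableSet.empty _ (optionalSigma ℱ)).compl (by
        intro _ _ h; simp at h)⟩
  measurableSet_compl A hA := ⟨hA.2, by rw [compl_compl]; exact hA.1⟩
  measurableSet_iUnion f hf := ⟨inner_iUnion ℱ ν f fun n => (hf n).1, by
    rw [Set.compl_iUnion]; exact inner_iInter ℱ ν _ fun n => (hf n).2⟩

lemma opt_inner {Ω : Type*} [mΩ : MeasurableSpace Ω] (ℱ : Filtration ℝ≥0 mΩ)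
    (ν : Measure (ℝ≥0 × Ω)) [IsFiniteMeasure ν] (A : Set (ℝ≥0 × Ω))
    (hA : MeasurableSet[optionalSigma ℱ] A) : InnerApp ℱ ν A := by
  have hle : optionalSigma ℱ ≤ appSigma ℱ ν := by
    refine iSup₂_le fun X hX => ?_
    have hXm : MeasurableSpace.comap (fun p : ℝ≥0 × Ω => X p.1 p.2) (borel ℝ) ≤
        optionalSigma ℱ := le_iSup₂_of_le X hX le_rfl
    have hcl : ∀ C : Set ℝ, IsClosed C →
        InnerApp ℱ ν ((fun p : ℝ≥0 × Ω => X p.1 p.2) ⁻¹' C) := by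
      intro C hC
      refine inner_self ℱ ν _ (hXm _ ⟨C, ?_, rfl⟩) ?_
      · rw [← BorelSpace.measurable_eq (α := ℝ)]; exact hC.measurableSet
      · intro ω t ht
        exact (hX.1 ω t).tendsto.eventually (hC.isOpen_compl.mem_nhds ht)
    rw [borel_eq_generateFrom_isClosed, MeasurableSpace.comap_generateFrom]
    refine MeasurableSpace.generateFrom_le ?_
    rintro _ ⟨C, hC, rfl⟩
    refine ⟨hcl C hC, ?_⟩
    obtain ⟨F, hF, -, hFU, -⟩ := (IsClosed.isOpen_compl (self := hC)).exists_iUnion_isClosed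
    rw [← Set.preimage_compl, ← hFU, Set.preimage_iUnion]
    exact inner_iUnion ℱ ν _ fun n => hcl _ (hF n)
  exact (hle A hA).1

lemma rclosed_inf {Ω : Type*} (B : Set (ℝ≥0 × Ω)) (hB : RClosed B) (ω : Ω)
    (hne : {t : ℝ≥0 | (t, ω) ∈ B}.Nonempty) : (sInf {t : ℝ≥0 | (t, ω) ∈ B}, ω) ∈ B := by
  by_contra h
  have h1 := hB ω _ h
  obtain ⟨u, hu, hsub⟩ := mem_nhdsGE_iff_exists_Ico_subset.mp h1
  obtain ⟨b, hb, hbu⟩ := exists_lt_of_csInf_lt hne hu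
  exact hsub ⟨csInf_le (OrderBot.bddBelow _) hb, hbu⟩ hb

lemma debut_stop {Ω : Type*} [mΩ : MeasurableSpace Ω] (μ : Measure Ω) [IsProbabilityMeasure μ]
    (ℱ : Filtration ℝ≥0 mΩ) (hUC : UsualConditions μ ℱ) (B : Set (ℝ≥0 × Ω))
    (hB : MeasurableSet[optionalSigma ℱ] B) (hBc : RClosed B) :
    ∃ T : Ω → ℝ≥0∞, IsStopTime ℱ T ∧ ∃ N : Set Ω, μ N = 0 ∧ ∀ ω ∈ Prod.snd '' B, ω ∉ N →
      T ω < ∞ ∧ ((T ω).toNNReal, ω) ∈ B := by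
  classical
  have h0 : ∀ t : ℝ≥0, ∃ E N : Set Ω, MeasurableSet[ℱ t] E ∧ MeasurableSet[ℱ t] N ∧
      E ⊆ Prod.snd '' ({p : ℝ≥0 × Ω | p.1 < t} ∩ B) ∧
      Prod.snd '' ({p : ℝ≥0 × Ω | p.1 < t} ∩ B) ⊆ E ∪ N ∧ (μ.trim (ℱ.le t)) N = 0 := fun t =>
    @proj_null Ω (ℱ t) (μ.trim (ℱ.le t)) _ _ (opt_prog ℱ B hB t)
  choose E N hE hN hEsub hsub hN0 using h0
  let u : ℚ → ℝ≥0 := fun q => Real.toNNReal q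
  let M : Set Ω := ⋃ q : ℚ, N (u q)
  have hMm : MeasurableSet M := MeasurableSet.iUnion fun q => ℱ.le _ _ (hN _)
  have hM0 : μ M = 0 := by
    refine measure_iUnion_null fun q => ?_
    have := hN0 (u q)
    rwa [trim_measurableSet_eq _ (hN _)] at this
  have hMF : ∀ t, MeasurableSet[ℱ t] M := fun t =>
    ℱ.mono (zero_le) _ (hUC.2 M hMm hM0)
  let S : Ω → Set ℝ≥0 := fun ω => {t : ℝ≥0 | (t, ω) ∈ B}
  let T : Ω → ℝ≥0∞ := fun ω => if ω ∈ M ∨ S ω = ∅ then ∞ else ((sInf (S ω) : ℝ≥0) : ℝ≥0∞)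
  have hTlt : ∀ q : ℚ, {ω | T ω < (u q : ℝ≥0∞)} = E (u q) \ M := by
    intro q
    ext ω
    by_cases hω : ω ∈ M
    · have : T ω = ∞ := if_pos (Or.inl hω)
      simp [this, hω]
    · have h1 : ω ∈ E (u q) \ M ↔ ω ∈ Prod.snd '' ({p : ℝ≥0 × Ω | p.1 < u q} ∩ B) := by
        constructor
        · intro h; exact hEsub _ h.1
        · intro h
          refine ⟨(hsub _ h).resolve_right fun h' => hω ?_, hω⟩
          exact Set.mem_iUnion.mpr ⟨q, h'⟩
      rw [h1]
      by_cases hS : S ω = ∅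
      · have : T ω = ∞ := if_pos (Or.inr hS)
        simp only [Set.mem_ofPred_eq, this, not_top_lt, false_iff]
        rintro ⟨⟨a, b⟩, ⟨_, h⟩, rfl⟩
        have : a ∈ S b := h
        rw [hS] at this; exact this
      · have hT : T ω = ((sInf (S ω) : ℝ≥0) : ℝ≥0∞) := if_neg (by tauto)
        have hne : (S ω).Nonempty := Set.nonempty_iff_ne_empty.mpr hS
        simp only [Set.mem_ofPred_eq, hT, ENNReal.coe_lt_coe]
        constructor
        · intro h
          exact ⟨(sInf (S ω), ω), ⟨h, rclosed_inf B hBc ω hne⟩, rfl⟩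
        · rintro ⟨⟨a, b⟩, ⟨h1', h2⟩, rfl⟩
          have h3 : a ∈ S b := h2
          exact (csInf_le (OrderBot.bddBelow _) h3).trans_lt h1'
  refine ⟨T, ?_, M, hM0, ?_⟩
  · intro t
    rw [hUC.1 t]
    simp only [MeasurableSpace.measurableSet_iInf]
    intro s hs
    have he : {ω | T ω ≤ (t : ℝ≥0∞)} =
        ⋂ q : ℚ, {ω | t < u q → u q < s → T ω < (u q : ℝ≥0∞)} := by
      ext ω
      simp only [Set.mem_iInter, Set.mem_ofPred_eq]
      constructor
      · intro h q h1 _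
        exact h.trans_lt (by exact_mod_cast h1)
      · intro h
        by_contra hlt
        push Not at hlt
        have hlt2 : (t : ℝ≥0∞) < min (T ω) s := lt_min hlt (by exact_mod_cast hs)
        obtain ⟨q, _, h1, h2⟩ := ENNReal.lt_iff_exists_rat_btwn.mp hlt2
        have h3 := h q (by exact_mod_cast h1)
          (by exact_mod_cast (h2.trans_le (min_le_right _ _)))
        exact absurd (h3.trans (h2.trans_le (min_le_left _ _))) (lt_irrefl _)
    rw [he]
    refine MeasurableSet.iInter fun q => ?_
    by_cases hq : t < u q ∧ u q < s
    · have : {ω | t < u q → u q < s → T ω < (u q : ℝ≥0∞)} = {ω | T ω < (u q : ℝ≥0∞)} := by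
        ext ω; simp [hq.1, hq.2]
      rw [this, hTlt]
      exact (ℱ.mono hq.2.le _ (hE _)).diff (hMF s)
    · have : {ω | t < u q → u q < s → T ω < (u q : ℝ≥0∞)} = Set.univ := by
        ext ω
        simp only [Set.mem_ofPred_eq, Set.mem_univ, iff_true]
        intro h1 h2; exact absurd ⟨h1, h2⟩ hq
      rw [this]; exact MeasurableSet.univ
  · rintro ω ⟨⟨a, b⟩, hab, rfl⟩ hω
    have hne : (S b).Nonempty := ⟨a, hab⟩
    have hT : T b = ((sInf (S b) : ℝ≥0) : ℝ≥0∞) := if_neg (by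
      rintro (h | h)
      · exact hω h
      · exact hne.ne_empty h)
    refine ⟨by simp [hT], ?_⟩
    have := rclosed_inf B hBc b hne
    simpa only [hT, ENNReal.toNNReal_coe] using this

lemma opt_section {Ω : Type*} [mΩ : MeasurableSpace Ω] (μ : Measure Ω) [IsProbabilityMeasure μ]
    (ℱ : Filtration ℝ≥0 mΩ) (hUC : UsualConditions μ ℱ) (A : Set (ℝ≥0 × Ω))
    (hA : MeasurableSet[optionalSigma ℱ] A)
    (h : ∀ T : Ω → ℝ≥0∞, IsStopTime ℱ T →
      ∀ᵐ ω ∂μ, ¬ (T ω < ∞ ∧ ((T ω).toNNReal, ω) ∈ A)) :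
    ∀ᵐ ω ∂μ, ∀ t, (t, ω) ∉ A := by
  have hgoal : μ (Prod.snd '' A) = 0 := by
    by_contra hne
    have hAm := opt_le ℱ A hA
    obtain ⟨E, R, hE, hR, hER, hc⟩ := section_gen μ A hAm (μ (Prod.snd '' A) / 2)
      (ENNReal.half_lt_self hne (measure_ne_top _ _))
    have hE0 : μ E ≠ 0 := fun h0 => by
      rw [h0] at hc
      exact (ENNReal.half_pos hne).ne' (le_antisymm hc zero_le)
    have hf : Measurable fun ω => (R ω, ω) := hR.prodMk measurable_id
    let ν : Measure (ℝ≥0 × Ω) := (μ.restrict E).map fun ω => (R ω, ω)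
    have hνA : μ E ≤ ν A := by
      rw [Measure.map_apply hf hAm, Measure.restrict_apply (hf hAm)]
      exact measure_mono fun ω hω => ⟨hER ω hω, hω⟩
    obtain ⟨B, hBA, hBm, hBc, hBν⟩ := opt_inner ℱ ν A hA (μ E / 2) (ENNReal.half_pos hE0).ne'
    obtain ⟨T, hT, N, hN, hTN⟩ := debut_stop μ ℱ hUC B hBm hBc
    have hB0 : μ (Prod.snd '' B) = 0 := by
      have h1 := h T hT
      have h2 : ∀ᵐ ω ∂μ, ω ∉ N := measure_eq_zero_iff_ae_notMem.mp hN
      rw [measure_eq_zero_iff_ae_notMem]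
      filter_upwards [h1, h2] with ω h1 h2 h3
      exact h1 ⟨(hTN ω h3 h2).1, hBA (hTN ω h3 h2).2⟩
    have hνB : ν B = 0 := by
      rw [Measure.map_apply hf (opt_le ℱ B hBm)]
      refine le_antisymm (((Measure.restrict_apply_le _ _).trans (measure_mono ?_)).trans hB0.le)
        zero_le
      intro ω hω
      exact ⟨_, hω, rfl⟩
    have : μ E ≤ μ E / 2 := by
      calc μ E ≤ ν A := hνA
        _ ≤ ν (B ∪ A \ B) := measure_mono fun p hp => by
            by_cases hb : p ∈ B
            · exact Or.inl hb
            · exact Or.inr ⟨hp, hb⟩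
        _ ≤ ν B + ν (A \ B) := measure_union_le _ _
        _ ≤ 0 + μ E / 2 := add_le_add hνB.le hBν
        _ = μ E / 2 := zero_add _
    exact absurd this (not_le.mpr (ENNReal.half_lt_self hE0 (measure_ne_top _ _)))
  rw [measure_eq_zero_iff_ae_notMem] at hgoal
  filter_upwards [hgoal] with ω hω t ht
  exact hω ⟨_, ht, rfl⟩

lemma stoppedVal_lt {Ω : Type*} (X : ℝ≥0 → Ω → ℝ) (T : Ω → ℝ≥0∞) (ω : Ω) (h : T ω < ∞) :
    stoppedVal X T ω = X (T ω).toNNReal ω := by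
  unfold stoppedVal
  exact Set.indicator_of_mem (s := {ω | T ω < ∞}) h _

lemma stoppedVal_top {Ω : Type*} (X : ℝ≥0 → Ω → ℝ) (T : Ω → ℝ≥0∞) (ω : Ω) (h : ¬ T ω < ∞) :
    stoppedVal X T ω = 0 := by
  unfold stoppedVal
  exact Set.indicator_of_notMem (s := {ω | T ω < ∞}) h _

/-- The optional projection operator maps `L_op` into itself and is a Markov projection:
a positive linear operator with `^o(^oX) = ^oX` up to indistinguishability and `^o1 = 1`. -/
theorem optionalProjection_markov_projection
    {Ω : Type*} [mΩ : MeasurableSpace Ω] (μ : Measure Ω) [IsProbabilityMeasure μ]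
    (ℱ : Filtration ℝ≥0 mΩ) (hUC : UsualConditions μ ℱ) :
    -- maps `L_op` into itself
    (∀ X Y : ℝ≥0 → Ω → ℝ, MemLop μ ℱ X → IsOptProj μ ℱ X Y → MemLop μ ℱ Y) ∧
    -- linearity
    (∀ X X' Y Y' : ℝ≥0 → Ω → ℝ, MemLop μ ℱ X → MemLop μ ℱ X' →
      IsOptProj μ ℱ X Y → IsOptProj μ ℱ X' Y' →
      IsOptProj μ ℱ (fun t ω => X t ω + X' t ω) fun t ω => Y t ω + Y' t ω) ∧
    (∀ (c : ℝ) (X Y : ℝ≥0 → Ω → ℝ), MemLop μ ℱ X → IsOptProj μ ℱ X Y →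
      IsOptProj μ ℱ (fun t ω => c * X t ω) fun t ω => c * Y t ω) ∧
    -- positivity
    (∀ X Y : ℝ≥0 → Ω → ℝ, MemLop μ ℱ X → IsOptProj μ ℱ X Y →
      (∀ᵐ ω ∂μ, ∀ t, 0 ≤ X t ω) → ∀ᵐ ω ∂μ, ∀ t, 0 ≤ Y t ω) ∧
    -- projection: `^o(^oX) = ^oX`
    (∀ X Y Z : ℝ≥0 → Ω → ℝ, MemLop μ ℱ X → IsOptProj μ ℱ X Y → IsOptProj μ ℱ Y Z →
      Indist μ Z Y) ∧
    -- `^o1 = 1`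
    IsOptProj μ ℱ (fun _ _ => (1 : ℝ)) fun _ _ => (1 : ℝ) := by
  refine ⟨?_, ?_, ?_, ?_, ?_, ?_⟩
  · intro X Y _ hY
    refine ⟨Measurable.mono hY.1 (opt_le ℱ) le_rfl, fun T hT => ?_⟩
    obtain ⟨η, hη, he⟩ := hY.2 T hT
    exact sigmaInt_of_meas μ _ (sigmaAt_le ℱ T hT) _ η hη.1 he
  · intro X X' Y Y' hX hX' hY hY'
    refine ⟨Measurable.add hY.1 hY'.1, fun T hT => ?_⟩
    obtain ⟨η, hη, he⟩ := hY.2 T hT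
    obtain ⟨η', hη', he'⟩ := hY'.2 T hT
    have hs : ∀ X X' : ℝ≥0 → Ω → ℝ, stoppedVal (fun t ω => X t ω + X' t ω) T =
        stoppedVal X T + stoppedVal X' T := by
      intro X X'
      ext ω
      by_cases h : T ω < ∞
      · simp only [Pi.add_apply, stoppedVal_lt _ T ω h]
      · simp only [Pi.add_apply, stoppedVal_top _ T ω h, add_zero]
    refine ⟨η + η', ?_, ?_⟩
    · rw [hs]
      exact gce_add μ _ (sigmaAt_le ℱ T hT) _ _ _ _ hη hη' (hX.2 T hT) (hX'.2 T hT)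
    · rw [hs]; exact he.add he'
  · intro c X Y hX hY
    refine ⟨Measurable.const_mul hY.1 c, fun T hT => ?_⟩
    obtain ⟨η, hη, he⟩ := hY.2 T hT
    have hs : ∀ X : ℝ≥0 → Ω → ℝ, stoppedVal (fun t ω => c * X t ω) T =
        c • stoppedVal X T := by
      intro X
      ext ω
      by_cases h : T ω < ∞
      · simp only [Pi.smul_apply, smul_eq_mul, stoppedVal_lt _ T ω h]
      · simp only [Pi.smul_apply, smul_eq_mul, stoppedVal_top _ T ω h, mul_zero]
    refine ⟨c • η, ?_, ?_⟩
    · rw [hs]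
      exact gce_smul μ _ (sigmaAt_le ℱ T hT) c _ _ hη (hX.2 T hT)
    · rw [hs]; exact he.const_smul c
  · intro X Y hX hY h0
    have hA : MeasurableSet[optionalSigma ℱ] {p : ℝ≥0 × Ω | Y p.1 p.2 < 0} :=
      hY.1 measurableSet_Iio
    have key := opt_section μ ℱ hUC _ hA (by
      intro T hT
      obtain ⟨η, hη, he⟩ := hY.2 T hT
      have h1 : ∀ᵐ ω ∂μ, 0 ≤ stoppedVal X T ω := by
        filter_upwards [h0] with ω hω
        exact Set.indicator_apply_nonneg fun _ => hω _
      have h2 := gce_nonneg μ _ (sigmaAt_le ℱ T hT) _ _ hη (hX.2 T hT) h1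
      filter_upwards [h2, he] with ω h2 h3 h4
      rw [h3, stoppedVal_lt _ T ω h4.1] at h2
      exact absurd h2 (not_le.mpr h4.2))
    filter_upwards [key] with ω hω t
    exact not_lt.mp (hω t)
  · intro X Y Z _ hY hZ
    have hA : MeasurableSet[optionalSigma ℱ] {p : ℝ≥0 × Ω | Z p.1 p.2 - Y p.1 p.2 ∈ ({0}ᶜ : Set ℝ)} :=
      (Measurable.sub hZ.1 hY.1) (measurableSet_singleton (0 : ℝ)).compl
    have key := opt_section μ ℱ hUC _ hA (by
      intro T hT
      obtain ⟨η0, hη0, he0⟩ := hY.2 T hT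
      obtain ⟨η, hη, he⟩ := hZ.2 T hT
      have h2 := gce_idem μ _ (sigmaAt_le ℱ T hT) _ _ η0 hη hη0.1 he0
      filter_upwards [h2, he] with ω h2 h3 h4
      rw [h3, stoppedVal_lt _ T ω h4.1, stoppedVal_lt _ T ω h4.1] at h2
      exact h4.2 (sub_eq_zero.mpr h2))
    filter_upwards [key] with ω hω t
    by_contra hne
    exact hω t fun h => hne (sub_eq_zero.mp h)
  · refine ⟨measurable_const, fun T hT => ⟨_, ⟨?_, fun _ _ _ => rfl⟩, ae_eq_refl _⟩⟩
    have hm : MeasurableSet[sigmaAt ℱ T hT] {ω | T ω < ∞} := by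
      refine ⟨?_, fun t => ?_⟩
      · have : {ω | T ω < ∞} = ⋃ n : ℕ, {ω | T ω ≤ ((n : ℝ≥0) : ℝ≥0∞)} := by
          ext ω
          simp only [Set.mem_iUnion, Set.mem_ofPred_eq]
          constructor
          · intro h
            obtain ⟨n, hn⟩ := ENNReal.exists_nat_gt h.ne
            exact ⟨n, by simpa using hn.le⟩
          · rintro ⟨n, hn⟩
            exact hn.trans_lt ENNReal.coe_lt_top
        rw [this]
        exact MeasurableSet.iUnion fun n =>
          le_iSup (fun t : ℝ≥0 => (ℱ t : MeasurableSpace Ω)) (n : ℝ≥0) _ (hT n)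
      · have : {ω | T ω < ∞} ∩ {ω | T ω ≤ (t : ℝ≥0∞)} = {ω | T ω ≤ (t : ℝ≥0∞)} := by
          ext ω
          simp only [Set.mem_inter_iff, Set.mem_ofPred_eq, and_iff_right_iff_imp]
          intro h; exact h.trans_lt ENNReal.coe_lt_top
        rw [this]; exact hT t
    exact (@measurable_const _ _ _ (sigmaAt ℱ T hT) (1 : ℝ)).indicator hm


end
end
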